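/- arXiv:1011.0120 — 4 statements merged into one kernel-verified Lean document; each statement's English description precedes it below -/
import Mathlib

section
/- The set of smooth expansions is comeagre in Exp(N, T₀). -/
open FirstOrder FirstOrder.Language

namespace GenExp

/-- The type of expansions of the `L`-structure `N` to the language `L.sum L'`:
an expansion is an interpretation of the new symbols, i.e. an `L'`-structure on `N`. -/
def Expansions (L L' : FirstOrder.Language.{0,0}) (N : Type) [L.Structure N] : Type :=
  L'.Structure N

variable {L L' : FirstOrder.Language.{0,0}} {N : Type} [L.Structure N]

/-- The underlying `L'`-structure of an expansion. -/
def Expansions.str (σ : Expansions L L' N) : L'.Structure N := σ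

/-- The `(L.sum L')`-structure on `N` determined by an expansion. -/
def Expansions.str0 (σ : Expansions L L' N) : (L.sum L').Structure N :=
  letI := σ.str
  inferInstance

/-- `(N, σ)` realizes the `L₀`-formula `φ` at the tuple `c` of parameters. -/
def Expansions.Realizes (σ : Expansions L L' N) {n : ℕ}
    (φ : (L.sum L').Formula (Fin n)) (c : Fin n → N) : Prop :=
  letI := σ.str0
  φ.Realize c

/-- `(N, σ)` is a model of the `L₀`-theory `T₀`. -/
def Expansions.ModelsTh (σ : Expansions L L' N) (T₀ : (L.sum L').Theory) : Prop :=
  letI := σ.str0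
  N ⊨ T₀

/-- The topology on `Exp(N)` generated by the sets `[φ]_N` for quantifier-free
`L₀`-sentences `φ` with parameters in `N` (coded as formulas plus an assignment). -/
instance (L L' : FirstOrder.Language.{0,0}) (N : Type) [L.Structure N] :
    TopologicalSpace (Expansions L L' N) :=
  TopologicalSpace.generateFrom
    {s | ∃ (n : ℕ) (φ : (L.sum L').Formula (Fin n)) (c : Fin n → N),
      φ.IsQF ∧ s = {σ : Expansions L L' N | σ.Realizes φ c}}

/-- `Exp(N, T₀)`, as a subset of `Exp(N)`. -/
def ExpSet (L L' : FirstOrder.Language.{0,0}) (N : Type) [L.Structure N] (T₀ : (L.sum L').Theory) :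
    Set (Expansions L L' N) :=
  {σ | σ.ModelsTh T₀}

/-- An `L₀`-sentence is universal modulo `T` if it is equivalent to a universal sentence
in every model of `T`. -/
def UniversalModulo (L L' : FirstOrder.Language.{0,0}) (T : L.Theory) (φ : (L.sum L').Sentence) : Prop :=
  ∃ ψ : (L.sum L').Sentence, BoundedFormula.IsUniversal ψ ∧
    ∀ (U : Type) [L.Structure U] [L'.Structure U], U ⊨ T → (U ⊨ φ ↔ U ⊨ ψ)

/-- A theory is universal modulo `T` if all its sentences are. -/
def UniversalTheoryModulo (L L' : FirstOrder.Language.{0,0}) (T : L.Theory)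
    (T₀ : (L.sum L').Theory) : Prop :=
  ∀ φ ∈ T₀, UniversalModulo L L' T φ

/-- `T` has quantifier elimination. -/
def HasQE (L : FirstOrder.Language.{0,0}) (T : L.Theory) : Prop :=
  ∀ (n : ℕ) (φ : L.Formula (Fin n)), ∃ ψ : L.Formula (Fin n), ψ.IsQF ∧ T ⊨ᵇ φ.iff ψ

/-- `T` is small: countably many complete `n`-types for every `n`. -/
def IsSmall (L : FirstOrder.Language.{0,0}) (T : L.Theory) : Prop :=
  ∀ n : ℕ, Countable (T.CompleteType (Fin n))

/-- `N` is (ω-)saturated: every finitely realized set of `L`-formulas in one variable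
with finitely many parameters in `N` is realized in `N`. -/
def IsSaturated (L : FirstOrder.Language.{0,0}) (N : Type) [L.Structure N] : Prop :=
  ∀ (k : ℕ) (c : Fin k → N) (p : Set (L.Formula (Fin k ⊕ Fin 1))),
    (∀ s : Finset (L.Formula (Fin k ⊕ Fin 1)), ↑s ⊆ p →
      ∃ x : N, ∀ φ ∈ s, φ.Realize (Sum.elim c fun _ => x)) →
    ∃ x : N, ∀ φ ∈ p, φ.Realize (Sum.elim c fun _ => x)

/-- `σ` is an existentially closed expansion: every quantifier-free `L₀`-formula with
parameters in `N` that has a solution in some model of `T₀` extending `(N, σ)` has a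
solution in `(N, σ)`. -/
def Expansions.IsEC (σ : Expansions L L' N) (T₀ : (L.sum L').Theory) : Prop :=
  letI := σ.str0
  ∀ (k n : ℕ) (φ : (L.sum L').Formula (Fin k ⊕ Fin n)) (c : Fin k → N), φ.IsQF →
    (∃ (U : Type) (iU : L.Structure U) (iU' : L'.Structure U),
      letI := iU; letI := iU';
      ∃ _j : N ↪[L.sum L'] U, (U ⊨ T₀) ∧ ∃ x : Fin n → U, φ.Realize (Sum.elim (_j ∘ c) x)) →
    ∃ x : Fin n → N, φ.Realize (Sum.elim c x)

/-- `σ` is a smooth expansion: it realizes every finitely consistent type of the form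
`p↾L(x) ∪ {ψ(x)}` with `ψ` quantifier-free in `L₀` and `p↾L` an `L`-type with finitely
many parameters. -/
def Expansions.IsSmooth (σ : Expansions L L' N) : Prop :=
  letI := σ.str0
  ∀ (k n : ℕ) (c : Fin k → N) (p : Set (L.Formula (Fin k ⊕ Fin n)))
    (ψ : (L.sum L').Formula (Fin k ⊕ Fin n)), ψ.IsQF →
    (∀ s : Finset (L.Formula (Fin k ⊕ Fin n)), ↑s ⊆ p →
      ∃ x : Fin n → N, ψ.Realize (Sum.elim c x) ∧
        ∀ χ ∈ s, Formula.Realize (L := L) (M := N) χ (Sum.elim c x)) →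
    ∃ x : Fin n → N, ψ.Realize (Sum.elim c x) ∧
      ∀ χ ∈ p, Formula.Realize (L := L) (M := N) χ (Sum.elim c x)

/-- The set `Y` of smooth existentially closed expansions in `Exp(N, T₀)`. -/
def YSet (L L' : FirstOrder.Language.{0,0}) (N : Type) [L.Structure N] (T₀ : (L.sum L').Theory) :
    Set (Expansions L L' N) :=
  {σ | σ.ModelsTh T₀ ∧ σ.IsSmooth ∧ σ.IsEC T₀}


/-- A general existentially closed model of `T₀` (in the class of models of `T₀`). -/
def IsECModel (L L' : FirstOrder.Language.{0,0}) (T₀ : (L.sum L').Theory)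
    (U : Type) [L.Structure U] [L'.Structure U] : Prop :=
  (U ⊨ T₀) ∧
  ∀ (k n : ℕ) (φ : (L.sum L').Formula (Fin k ⊕ Fin n)) (c : Fin k → U), φ.IsQF →
    (∃ (V : Type) (iV : L.Structure V) (iV' : L'.Structure V),
      letI := iV; letI := iV';
      ∃ _j : U ↪[L.sum L'] V, (V ⊨ T₀) ∧ ∃ x : Fin n → V, φ.Realize (Sum.elim (_j ∘ c) x)) →
    ∃ x : Fin n → U, φ.Realize (Sum.elim c x)

/-- All existentially closed models of `T₀` have the same existential theory. -/
def SameExistentialTheory (L L' : FirstOrder.Language.{0,0}) (T₀ : (L.sum L').Theory) : Prop :=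
  ∀ (U : Type) [L.Structure U] [L'.Structure U] (V : Type) [L.Structure V] [L'.Structure V],
    IsECModel L L' T₀ U → IsECModel L L' T₀ V →
    ∀ φ : (L.sum L').Sentence, BoundedFormula.IsExistential φ → ((U ⊨ φ) ↔ (V ⊨ φ))

/-- An existential quasifinite formula `∃ y (p(x,y) ∧ φ(x,y))`, where `p` is a
parameter-free `L`-type and `φ` is a quantifier-free `L₀`-formula. -/
structure EQF (L L' : FirstOrder.Language.{0,0}) (n : ℕ) : Type where
  m : ℕ
  p : Set (L.Formula (Fin n ⊕ Fin m))
  φ : (L.sum L').Formula (Fin n ⊕ Fin m)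
  qf : φ.IsQF

/-- Realization of an existential quasifinite formula at a tuple `b` in `(N, σ)`. -/
def EQF.RealizeAt {n : ℕ} (π : EQF L L' n) (σ : Expansions L L' N) (b : Fin n → N) : Prop :=
  letI := σ.str0
  ∃ y : Fin π.m → N,
    (∀ χ ∈ π.p, Formula.Realize (L := L) (M := N) χ (Sum.elim b y)) ∧
      π.φ.Realize (Sum.elim b y)

/-- The complete parameter-free `L₀`-type of the tuple `a` in `(N, σ)`. -/
def fullType (σ : Expansions L L' N) {n : ℕ} (a : Fin n → N) :
    Set ((L.sum L').Formula (Fin n)) :=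
  {φ | σ.Realizes φ a}

/-- `p↾1`: the universal and existential formulas in `p`. -/
def restr1 {L L' : FirstOrder.Language.{0,0}} {n : ℕ}
    (p : Set ((L.sum L').Formula (Fin n))) : Set ((L.sum L').Formula (Fin n)) :=
  {φ ∈ p | BoundedFormula.IsUniversal φ ∨ BoundedFormula.IsExistential φ}

/-- The 1-diagram of `σ` at `b`: all universal and existential formulas satisfied by `b`
in `(N, σ)` (coding sentences with parameters `b` as formulas). -/
def diag1 (σ : Expansions L L' N) {n : ℕ} (b : Fin n → N) :
    Set ((L.sum L').Formula (Fin n)) :=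
  restr1 (fullType σ b)

variable (L L' N) in
/-- The set `D_b` of 1-diagrams at `b` of expansions in `Y`. -/
def DSet (T₀ : (L.sum L').Theory) {n : ℕ} (b : Fin n → N) :
    Set (Set ((L.sum L').Formula (Fin n))) :=
  {d | ∃ σ ∈ YSet L L' N T₀, d = diag1 σ b}

variable (L L' N) in
/-- The basic subset `[π(b)]_D` of `D_b`. -/
def DBasic (T₀ : (L.sum L').Theory) {n : ℕ} (b : Fin n → N) (π : EQF L L' n) :
    Set (Set ((L.sum L').Formula (Fin n))) :=
  {d | ∃ σ ∈ YSet L L' N T₀, d = diag1 σ b ∧ π.RealizeAt σ b}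

variable (L L' N) in
/-- The topology on `D_b` generated by the sets `[π(b)]_D`. -/
def DTop (T₀ : (L.sum L').Theory) {n : ℕ} (b : Fin n → N) :
    TopologicalSpace ↥(DSet L L' N T₀ b) :=
  TopologicalSpace.generateFrom
    {s | ∃ π : EQF L L' n, s = {d | ↑d ∈ DBasic L L' N T₀ b π}}

variable (L L' N) in
/-- The set `S_x^Y` of types `p↾1` for `p` a complete parameter-free type realized in `Y`. -/
def SSet (T₀ : (L.sum L').Theory) (n : ℕ) : Set (Set ((L.sum L').Formula (Fin n))) :=
  {q | ∃ σ ∈ YSet L L' N T₀, ∃ a : Fin n → N, q = diag1 σ a}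

variable (L L' N) in
/-- The basic subset `[π(x)]_S` of `S_x^Y`. -/
def SBasic (T₀ : (L.sum L').Theory) {n : ℕ} (π : EQF L L' n) :
    Set (Set ((L.sum L').Formula (Fin n))) :=
  {q | ∃ σ ∈ YSet L L' N T₀, ∃ a : Fin n → N, q = diag1 σ a ∧ π.RealizeAt σ a}

variable (L L' N) in
/-- The topology on `S_x^Y` generated by the sets `[π(x)]_S`. -/
def STop (T₀ : (L.sum L').Theory) (n : ℕ) : TopologicalSpace ↥(SSet L L' N T₀ n) :=
  TopologicalSpace.generateFrom
    {s | ∃ π : EQF L L' n, s = {q | ↑q ∈ SBasic L L' N T₀ π}}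

variable (L L' N) in
/-- `α` is an e-atomic expansion: it is in `Y` and each of its 1-diagrams is an
isolated point of `D_b`. -/
def IsEAtomic (T₀ : (L.sum L').Theory) (α : Expansions L L' N) : Prop :=
  α ∈ YSet L L' N T₀ ∧ ∀ (n : ℕ) (b : Fin n → N),
    @IsOpen _ (DTop L L' N T₀ b) {d | (d : Set ((L.sum L').Formula (Fin n))) = diag1 α b}

/-- The conjugate expansion `σ^g` of `σ` under an automorphism `g` of `N`. -/
def conjExp (g : N ≃[L] N) (σ : Expansions L L' N) : Expansions L L' N :=
  show L'.Structure N from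
  { funMap := fun {_} F a => g ((σ.str).funMap F fun i => g.symm (a i))
    RelMap := fun {_} R a => (σ.str).RelMap R fun i => g.symm (a i) }

variable (L L' N) in
/-- `τ` is Truss generic: its conjugacy class is comeagre in `Exp(N, T₀)`. -/
def IsTrussGeneric (T₀ : (L.sum L').Theory) (τ : Expansions L L' N) : Prop :=
  τ.ModelsTh T₀ ∧
    {σ : ↥(ExpSet L L' N T₀) | ∃ g : N ≃[L] N, (σ : Expansions L L' N) = conjExp g τ} ∈
      residual ↥(ExpSet L L' N T₀)


variable (L L' N) in
/-- The quantifier-free formula `φ` (with parameters `c`) has a solution in `(N, σ)`. -/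
def SolvableIn (σ : Expansions L L' N) {k n : ℕ}
    (φ : (L.sum L').Formula (Fin k ⊕ Fin n)) (c : Fin k → N) : Prop :=
  letI := σ.str0
  ∃ x : Fin n → N, φ.Realize (Sum.elim c x)

variable (L L' N) in
/-- The formula `φ` (with parameters `c`) has a solution in some model of `T₀`
extending `(N, σ)`. -/
def SolvableInExtension (T₀ : (L.sum L').Theory) (σ : Expansions L L' N) {k n : ℕ}
    (φ : (L.sum L').Formula (Fin k ⊕ Fin n)) (c : Fin k → N) : Prop :=
  letI := σ.str0
  ∃ (U : Type) (iU : L.Structure U) (iU' : L'.Structure U),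
    letI := iU; letI := iU';
    ∃ _j : N ↪[L.sum L'] U, (U ⊨ T₀) ∧ ∃ x : Fin n → U, φ.Realize (Sum.elim (_j ∘ c) x)

section Countability

open TopologicalSpace

/-- A countable compact totally separated space is second countable. -/
theorem secondCountableTopology_of_countable {X : Type*} [TopologicalSpace X] [Countable X]
    [CompactSpace X] [TotallySeparatedSpace X] : SecondCountableTopology X := by
  have h : ∀ q : {q : X × X // q.1 ≠ q.2}, ∃ U : Set X, IsClopen U ∧ q.1.1 ∈ U ∧ q.1.2 ∉ U := by
    rintro ⟨⟨x, y⟩, hxy⟩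
    obtain ⟨U, hU, hx, hy⟩ := exists_isClopen_of_totally_separated hxy
    exact ⟨U, hU, hx, hy⟩
  choose U hU hU₁ hU₂ using h
  have hf : Continuous (fun x q => (U q).boolIndicator x) :=
    continuous_pi fun q => (continuous_boolIndicator_iff_isClopen _).2 (hU q)
  have hinj : Function.Injective (fun x q => (U q).boolIndicator x) := by
    intro x y hxy
    by_contra hne
    have := congrFun hxy ⟨(x, y), hne⟩
    have hx := (Set.mem_iff_boolIndicator _ _).1 (hU₁ ⟨(x, y), hne⟩)
    have hy := (Set.notMem_iff_boolIndicator _ _).1 (hU₂ ⟨(x, y), hne⟩)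
    simp only at this hx hy
    rw [hx, hy] at this
    simp at this
  exact (hf.isClosedEmbedding hinj).isEmbedding.secondCountableTopology

variable {T : L.Theory}

/-- A small theory has countably many formulas in finitely many variables, up to equivalence
in a given model. -/
theorem countable_definable [Nonempty N] [N ⊨ T] (hsmall : IsSmall L T) (n : ℕ) :
    {s : Set (Fin n → N) | ∃ φ : L.Formula (Fin n), s = {v | φ.Realize v}}.Countable := by
  have := hsmall n
  have : SecondCountableTopology (T.CompleteType (Fin n)) := secondCountableTopology_of_countable
  have : Countable (Clopens (T.CompleteType (Fin n))) :=
    Clopens.countable_iff_secondCountable.2 inferInstance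
  let F : Clopens (T.CompleteType (Fin n)) → Set (Fin n → N) := fun U => {v | T.typeOf v ∈ U}
  refine (Set.countable_range F).mono ?_
  rintro _ ⟨φ, rfl⟩
  refine ⟨⟨T.typesWith (Formula.equivSentence φ), CompleteType.isClopen_typesWith _⟩, ?_⟩
  ext v
  exact Theory.CompleteType.formula_mem_typeOf (T := T) (M := N)

/-- A small theory has countably many types in finitely many variables. -/
theorem countable_types (hsmall : IsSmall L T) (α : Type) [Finite α] :
    {t : Set (L.Formula α) | ∃ (U : Type) (_ : L.Structure U), Nonempty U ∧ U ⊨ T ∧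
      ∃ v : α → U, t = {φ | φ.Realize v}}.Countable := by
  obtain ⟨n, ⟨e⟩⟩ := Finite.exists_equiv_fin α
  have := hsmall n
  let F : T.CompleteType (Fin n) → Set (L.Formula α) :=
    fun p => {φ | Formula.equivSentence (φ.relabel e) ∈ p}
  refine (Set.countable_range F).mono ?_
  rintro _ ⟨U, iU, hU, hT, v, rfl⟩
  refine ⟨T.typeOf (v ∘ e.symm), ?_⟩
  ext φ
  simp only [F, Set.mem_ofPred_eq, Theory.CompleteType.formula_mem_typeOf, Formula.realize_relabel]
  rw [Function.comp_assoc, Equiv.symm_comp_self, Function.comp_id]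

/-- The language of all interpretations in `N` of symbols of `L`. -/
def interpLang (L : FirstOrder.Language.{0,0}) (N : Type) [L.Structure N] :
    FirstOrder.Language.{0,0} where
  Functions n := Set.range fun f : L.Functions n => (Structure.funMap f : (Fin n → N) → N)
  Relations n := Set.range fun R : L.Relations n => (Structure.RelMap R : (Fin n → N) → Prop)

instance : (interpLang L N).Structure N where
  funMap f := f.1
  RelMap R := R.1

variable (L N) in
/-- The language map sending a symbol to its interpretation. -/
def interpHom : L →ᴸ interpLang L N where
  onFunction _ f := ⟨_, f, rfl⟩
  onRelation _ R := ⟨_, R, rfl⟩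

instance : (interpHom L N).IsExpansionOn N where
  map_onFunction _ _ := rfl
  map_onRelation _ _ := rfl

theorem countable_interpLang_symbols [Nonempty N] [N ⊨ T] (hsmall : IsSmall L T) :
    Countable (interpLang L N).Symbols := by
  have hfun : ∀ n, Countable ((interpLang L N).Functions n) := fun n => by
    have := (countable_definable (N := N) hsmall (n + 1)).to_subtype
    refine Function.Injective.countable (β := {s : Set (Fin (n + 1) → N) |
      ∃ φ : L.Formula (Fin (n + 1)), s = {v | φ.Realize v}})
      (f := fun f => ⟨{v | f.1 (Fin.init v) = v (Fin.last n)}, ?_⟩) ?_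
    · obtain ⟨_, f, rfl⟩ := f
      refine ⟨Term.equal (Term.func f fun i => Term.var i.castSucc)
        (Term.var (Fin.last n)), ?_⟩
      ext v
      simp only [Set.mem_ofPred_eq, Formula.realize_equal, Term.realize_func, Term.realize_var]
      rfl
    · intro f g hfg
      refine Subtype.ext (funext fun v => ?_)
      have := Set.ext_iff.1 (Subtype.ext_iff.1 hfg) (Fin.snoc v (f.1 v))
      simp only [Set.mem_ofPred_eq, Fin.init_snoc, Fin.snoc_last, true_iff] at this
      exact this.symm
  have hrel : ∀ n, Countable ((interpLang L N).Relations n) := fun n => by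
    have := (countable_definable (N := N) hsmall n).to_subtype
    refine Function.Injective.countable (β := {s : Set (Fin n → N) |
      ∃ φ : L.Formula (Fin n), s = {v | φ.Realize v}}) (f := fun R => ⟨{v | R.1 v}, ?_⟩) ?_
    · obtain ⟨_, R, rfl⟩ := R
      refine ⟨Relations.formula R fun i => Term.var i, ?_⟩
      ext v
      simp only [Set.mem_ofPred_eq, Formula.realize_rel, Term.realize_var]
    · intro R S hRS
      refine Subtype.ext (funext fun v => ?_)
      exact propext (Set.ext_iff.1 (Subtype.ext_iff.1 hRS) v)
  unfold Language.Symbols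
  infer_instance

/-- Up to equivalence in all expansions of `N`, a set of formulas in finitely many variables is
countable. -/
theorem exists_countable_cover [Nonempty N] [N ⊨ T] (hsmall : IsSmall L T)
    [Finite (Σ i, L'.Functions i)] [Finite (Σ i, L'.Relations i)] (α : Type) [Countable α]
    (Q : Set ((L.sum L').Formula α)) :
    ∃ S ⊆ Q, S.Countable ∧ ∀ ψ ∈ Q, ∃ ψ₀ ∈ S, ∀ (_ : L'.Structure N) (v : α → N),
      ψ₀.Realize v ↔ ψ.Realize v := by
  have := countable_interpLang_symbols (N := N) hsmall
  have : Countable L'.Symbols := by unfold Language.Symbols; infer_instance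
  have : Countable ((interpLang L N).sum L').Symbols := by
    have : ∀ i, Countable (L'.Functions i) := fun i =>
      (sigma_mk_injective (β := L'.Functions) (i := i)).countable
    have : ∀ i, Countable (L'.Relations i) := fun i =>
      (sigma_mk_injective (β := L'.Relations) (i := i)).countable
    have h₁ : ∀ i, Countable ((interpLang L N).Functions i) := fun i =>
      (Sum.inl_injective.comp
        (sigma_mk_injective (β := (interpLang L N).Functions) (i := i))).countable
          (β := (interpLang L N).Symbols)
    have h₂ : ∀ i, Countable ((interpLang L N).Relations i) := fun i =>
      (Sum.inr_injective.comp
        (sigma_mk_injective (β := (interpLang L N).Relations) (i := i))).countable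
          (β := (interpLang L N).Symbols)
    unfold Language.Symbols Language.sum
    infer_instance
  let g : L.sum L' →ᴸ (interpLang L N).sum L' := (interpHom L N).sumMap (LHom.id L')
  obtain ⟨S, hSQ, hS⟩ := Set.SurjOn.exists_bijOn_subset (Set.surjOn_image g.onFormula Q)
  refine ⟨S, hSQ, ?_, fun ψ hψ => ?_⟩
  · exact Set.countable_of_injective_of_countable_image hS.injOn (Set.to_countable _)
  · obtain ⟨ψ₀, h₀, h⟩ := hS.surjOn (Set.mem_image_of_mem _ hψ)
    refine ⟨ψ₀, h₀, fun i v => ?_⟩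
    rw [← LHom.realize_onFormula g ψ₀, h, LHom.realize_onFormula g ψ]

end Countability

section Ultrapower

/-- The ultrapower of `A` along an ultrafilter. -/
abbrev UltraPow {I : Type} (u : Ultrafilter I) (A : Type) : Type :=
  (u : Filter I).Product fun _ => A

/-- The class of a function in the ultrapower. -/
def UltraPow.mk {I : Type} (u : Ultrafilter I) {A : Type} (f : I → A) : UltraPow u A :=
  Quotient.mk _ f

theorem UltraPow.exists_mk {I A : Type} {u : Ultrafilter I} (x : UltraPow u A) :
    ∃ f : I → A, UltraPow.mk u f = x :=
  Quotient.exists_rep x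

variable {K : FirstOrder.Language.{0,0}} {A : Type} [K.Structure A] [Nonempty A]

theorem ultraPow_realize {I : Type} (u : Ultrafilter I) {α : Type} (φ : K.Formula α)
    (v : α → I → A) (w : α → UltraPow u A) (hw : ∀ i, w i = UltraPow.mk u (v i)) :
    φ.Realize w ↔ ∀ᶠ a in (u : Filter I), φ.Realize fun i => v i a := by
  obtain rfl : w = _ := funext hw
  exact Ultraproduct.realize_formula_cast φ v

theorem ultraPow_realizes_of_countable {α β : Type} (c : α → UltraPow (Filter.hyperfilter ℕ) A)
    (P : Set (K.Formula (α ⊕ β))) (hP : P.Countable)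
    (hfin : ∀ s : Finset (K.Formula (α ⊕ β)), ↑s ⊆ P →
      ∃ x : β → UltraPow (Filter.hyperfilter ℕ) A, ∀ φ ∈ s, φ.Realize (Sum.elim c x)) :
    ∃ x : β → UltraPow (Filter.hyperfilter ℕ) A, ∀ φ ∈ P, φ.Realize (Sum.elim c x) := by
  classical
  rcases P.eq_empty_or_nonempty with rfl | hne
  · obtain ⟨x, -⟩ := hfin ∅ (by simp)
    exact ⟨x, by simp⟩
  obtain ⟨f, rfl⟩ := hP.exists_eq_range hne
  choose c' hc' using fun i => UltraPow.exists_mk (c i)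
  let good : ℕ → ℕ → Prop := fun a i =>
    ∃ x : β → A, ∀ j ≤ i, (f j).Realize (Sum.elim (fun k => c' k a) x)
  have hgood : ∀ i, ∀ᶠ a in (Filter.hyperfilter ℕ : Filter ℕ), good a i := by
    intro i
    obtain ⟨x, hx⟩ := hfin ((Finset.range (i + 1)).image f) (by
      intro φ hφ
      obtain ⟨j, -, rfl⟩ := Finset.mem_image.1 hφ
      exact ⟨j, rfl⟩)
    choose x' hx' using fun i => UltraPow.exists_mk (x i)
    have key : ∀ j ∈ Finset.range (i + 1), ∀ᶠ a in (Filter.hyperfilter ℕ : Filter ℕ),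
        (f j).Realize (Sum.elim (fun k => c' k a) fun k => x' k a) := by
      intro j hj
      have := (ultraPow_realize (Filter.hyperfilter ℕ) (f j) (Sum.elim c' x')
        (Sum.elim c x) (by rintro (k | k) <;> simp [hc', hx'])).1
        (hx _ (Finset.mem_image_of_mem f hj))
      filter_upwards [this] with a ha
      convert! ha using 1
      ext (k | k) <;> rfl
    filter_upwards [(Filter.eventually_all_finset _).2 key] with a ha
    exact ⟨fun k => x' k a, fun j hj => ha j (Finset.mem_range.2 (Nat.lt_succ_of_le hj))⟩
  have hchoice : ∀ a, ∃ x : β → A, ∀ j ≤ a, good a j →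
      (f j).Realize (Sum.elim (fun k => c' k a) x) := by
    intro a
    by_cases h : ∃ j ≤ a, good a j
    · obtain ⟨j, hja, hj⟩ := h
      obtain ⟨x, hx⟩ := Nat.findGreatest_spec (P := good a) hja hj
      exact ⟨x, fun i hia hi => hx i (Nat.le_findGreatest hia hi)⟩
    · push Not at h
      exact ⟨fun _ => Classical.arbitrary A, fun j hj hg => (h j hj hg).elim⟩
  choose x hx using hchoice
  refine ⟨fun k => UltraPow.mk _ fun a => x a k, ?_⟩
  rintro _ ⟨j, rfl⟩
  refine (ultraPow_realize (Filter.hyperfilter ℕ) (f j) (Sum.elim c' fun k a => x a k) _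
    (by rintro (k | k) <;> simp [hc'])).2 ?_
  have hlarge : ∀ᶠ a in (Filter.hyperfilter ℕ : Filter ℕ), j ≤ a :=
    Nat.hyperfilter_le_atTop (Filter.eventually_ge_atTop j)
  filter_upwards [hgood j, hlarge] with a ha hja
  convert! hx a j hja ha using 1
  ext (k | k) <;> rfl

/-- If formulas are countable up to equivalence in `A`, then `A` has an `ℵ₁`-saturated elementary
extension. -/
theorem exists_saturated_extension
    (hcov : ∀ (α : Type) [Countable α] (Q : Set (K.Formula α)), ∃ S ⊆ Q, S.Countable ∧
      ∀ ψ ∈ Q, ∃ ψ₀ ∈ S, ∀ v : α → A, ψ₀.Realize v ↔ ψ.Realize v) :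
    ∃ (B : Type) (_ : K.Structure B) (j : A → B),
      (∀ (α : Type) (φ : K.Formula α) (v : α → A), φ.Realize (j ∘ v) ↔ φ.Realize v) ∧
      ∀ (α β : Type) [Countable α] [Countable β] (c : α → B) (P : Set (K.Formula (α ⊕ β))),
        (∀ s : Finset (K.Formula (α ⊕ β)), ↑s ⊆ P →
          ∃ x : β → B, ∀ φ ∈ s, φ.Realize (Sum.elim c x)) →
        ∃ x : β → B, ∀ φ ∈ P, φ.Realize (Sum.elim c x) := by
  refine ⟨UltraPow (Filter.hyperfilter ℕ) A, inferInstance, fun a => UltraPow.mk _ fun _ => a, ?_, ?_⟩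
  · intro α φ v
    refine (ultraPow_realize (Filter.hyperfilter ℕ) φ (fun i _ => v i) _ fun _ => rfl).trans ?_
    simp
  · intro α β _ _ c P hP
    obtain ⟨S, hSP, hS, hcov⟩ := hcov _ P
    obtain ⟨x, hx⟩ := ultraPow_realizes_of_countable c S hS fun s hs => hP s (hs.trans hSP)
    refine ⟨x, fun φ hφ => ?_⟩
    obtain ⟨ψ, hψ, h⟩ := hcov φ hφ
    choose v hv using fun i => UltraPow.exists_mk (Sum.elim c x i)
    have := hx ψ hψ
    rw [ultraPow_realize (Filter.hyperfilter ℕ) _ v _ fun i => (hv i).symm] at this ⊢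
    exact this.mono fun a ha => (h _).1 ha

/-- The type of an ultrafilter is realized in a model of the theory. -/
theorem countable_ultrafilter_types {T : L.Theory} [Nonempty N] [N ⊨ T] (hsmall : IsSmall L T)
    (α : Type) [Finite α] :
    {t : Set (L.Formula α) | ∃ u : Ultrafilter (α → N),
      t = {φ | ∀ᶠ v in (u : Filter (α → N)), φ.Realize v}}.Countable := by
  refine (countable_types hsmall α).mono ?_
  rintro _ ⟨u, rfl⟩
  refine ⟨UltraPow u N, inferInstance, inferInstance, ⟨fun φ hφ => ?_⟩,
    fun i => UltraPow.mk u fun v => v i, ?_⟩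
  · rw [Ultraproduct.sentence_realize]
    exact Filter.Eventually.of_forall fun _ => Theory.realize_sentence_of_mem T hφ
  · ext φ
    exact (ultraPow_realize u φ (fun i v => v i) _ fun _ => rfl).symm

end Ultrapower

section CountableModel

theorem exists_eq_sumStructure {A : Type} (S : (L.sum L').Structure A) :
    ∃ (i : L.Structure A) (i' : L'.Structure A), S = @sumStructure L L' A i i' := by
  refine ⟨(LHom.sumInl : L →ᴸ L.sum L').reduct A, (LHom.sumInr : L' →ᴸ L.sum L').reduct A, ?_⟩
  ext n f x
  · cases f <;> rfl
  · cases f <;> rfl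

/-- The language with a function symbol for each type realized in `A`. -/
def typeLang (L : FirstOrder.Language.{0,0}) (A : Type) [L.Structure A] :
    FirstOrder.Language.{0,0} where
  Functions k := {t : Set (L.Formula (Fin (k + 1))) | ∃ v : Fin (k + 1) → A, t = {φ | φ.Realize v}}
  Relations _ := Empty

/-- Each type symbol picks a realization of the type over the given parameters, if there is one. -/
noncomputable abbrev typeLangStructure (A : Type) [L.Structure A] [Nonempty A] :
    (typeLang L A).Structure A where
  funMap {k} t c := Classical.epsilon fun y =>
    t.1 = {φ | φ.Realize (Fin.snoc (α := fun _ => A) c y : Fin (k + 1) → A)}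
  RelMap R := R.elim

theorem isElementary_of_realizes {A B : Type} [L.Structure A] [L.Structure B] (ι : A ↪[L] B)
    (h : ∀ (k : ℕ) (c : Fin k → A) (y : B), ∃ y' : A, ∀ φ : L.Formula (Fin (k + 1)),
      φ.Realize (Fin.snoc (α := fun _ => B) (ι ∘ c) (ι y')) ↔
        φ.Realize (Fin.snoc (α := fun _ => B) (ι ∘ c) y))
    {α : Type} (φ : L.Formula α) (v : α → A) : φ.Realize (ι ∘ v) ↔ φ.Realize v := by
  let ι' : A ↪ₑ[L] B := ⟨ι, fun n φ x => ι.isElementary_of_exists (fun n φ x a ha => by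
    obtain ⟨b, hb⟩ := h n x a
    refine ⟨b, ?_⟩
    have := hb (φ.toFormula.relabel (Sum.elim Empty.elim id))
    simp only [Formula.realize_relabel, BoundedFormula.realize_toFormula] at this
    have key : ∀ w : Fin (n + 1) → B, φ.Realize default w ↔
        φ.Realize ((w ∘ Sum.elim Empty.elim id) ∘ Sum.inl)
          ((w ∘ Sum.elim Empty.elim id) ∘ Sum.inr) := fun w => by
      rw [Subsingleton.elim ((w ∘ Sum.elim Empty.elim id) ∘ Sum.inl) default]
      rfl
    rw [key] at ha ⊢
    exact this.2 ha) φ x⟩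
  exact ι'.map_formula φ v

/-- A downward Löwenheim–Skolem theorem producing saturated countable models. -/
theorem exists_countable_saturated_submodel {B : Type} [L.Structure B] [L'.Structure B] [Nonempty B]
    [Countable (Σ i, L'.Functions i)]
    (htypes : ∀ k : ℕ, {t : Set (L.Formula (Fin k)) | ∃ v : Fin k → B,
      t = {φ | φ.Realize v}}.Countable)
    (hsat : IsSaturated L B) {s : Set B} (hs : s.Countable) :
    ∃ (M : Type) (_ : L.Structure M) (_ : L'.Structure M) (ι : M ↪[L.sum L'] B),
      Countable M ∧ s ⊆ Set.range ι ∧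
      (∀ (α : Type) (φ : L.Formula α) (v : α → M), φ.Realize (ι ∘ v) ↔ φ.Realize v) ∧
      IsSaturated L M := by
  let := typeLangStructure (L := L) B
  let C : (L'.sum (typeLang L B)).Substructure B := Substructure.closure _ s
  have : Countable (Σ k, (L'.sum (typeLang L B)).Functions k) := by
    have h₁ : ∀ i, Countable (L'.Functions i) := fun i =>
      (sigma_mk_injective (β := L'.Functions) (i := i)).countable
    have h₂ : ∀ i, Countable ((typeLang L B).Functions i) := fun i => (htypes (i + 1)).to_subtype
    unfold Language.sum
    infer_instance
  have hC : Countable C := hs.substructure_closure _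
  have hsC : s ⊆ C := Substructure.subset_closure
  have hwit : ∀ (k : ℕ) (c : Fin k → B) (_ : ∀ i, c i ∈ C) (y : B), ∃ y' ∈ C,
      ∀ φ : L.Formula (Fin (k + 1)), φ.Realize (Fin.snoc (α := fun _ => B) c y') ↔
        φ.Realize (Fin.snoc (α := fun _ => B) c y) := by
    intro k c hc y
    let t : (typeLang L B).Functions k :=
      ⟨{φ | φ.Realize (Fin.snoc (α := fun _ => B) c y : Fin (k + 1) → B)}, _, rfl⟩
    have ht := Classical.epsilon_spec (p := fun y' => t.1 =
      {φ | φ.Realize (Fin.snoc (α := fun _ => B) c y' : Fin (k + 1) → B)}) ⟨y, rfl⟩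
    exact ⟨_, C.fun_mem (Sum.inr t) c hc, fun φ => (Set.ext_iff.1 ht φ).symm⟩
  let S : (L.sum L').Substructure B :=
    { carrier := C
      fun_mem := by
        rintro n (f | f) x hx
        · obtain ⟨y, hy, h⟩ := hwit n x hx (Structure.funMap f x)
          have := h (Term.equal (Term.func f fun i => Term.var i.castSucc) (Term.var (Fin.last n)))
          simp only [Formula.realize_equal, Term.realize_func, Term.realize_var, Fin.snoc_castSucc,
            Fin.snoc_last, iff_true] at this
          rw [← this] at hy
          exact hy
        · exact C.fun_mem (Sum.inl f) x hx }
  have hSrange : Set.range S.subtype = (C : Set B) := Subtype.range_coe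
  obtain ⟨M, str, ι, hM, hsM, hwitM⟩ : ∃ (M : Type) (str : (L.sum L').Structure M)
      (ι : M ↪[L.sum L'] B), Countable M ∧ s ⊆ Set.range ι ∧
      ∀ (k : ℕ) (c : Fin k → M) (y : B), ∃ y' : M, ∀ φ : L.Formula (Fin (k + 1)),
        φ.Realize (Fin.snoc (α := fun _ => B) (ι ∘ c) (ι y')) ↔
          φ.Realize (Fin.snoc (α := fun _ => B) (ι ∘ c) y) := by
    refine ⟨S, inferInstance, S.subtype, hC, hSrange.symm ▸ hsC, fun k c y => ?_⟩
    obtain ⟨y', hy', h⟩ := hwit k (fun i => c i) (fun i => (c i).2) y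
    exact ⟨⟨y', hy'⟩, h⟩
  clear_value S
  obtain ⟨i, i', rfl⟩ := exists_eq_sumStructure str
  let ιL : M ↪[L] B :=
    { toFun := ι
      inj' := ι.injective
      map_fun' := fun f x => ι.map_fun (Sum.inl f) x
      map_rel' := fun R x => ι.map_rel (Sum.inl R) x }
  have hel : ∀ (α : Type) (φ : L.Formula α) (v : α → M), φ.Realize (ι ∘ v) ↔ φ.Realize v :=
    fun α φ v => isElementary_of_realizes ιL hwitM φ v
  refine ⟨M, i, i', ι, hM, hsM, hel, fun k c p hp => ?_⟩
  obtain ⟨y, hy⟩ := hsat k (ι ∘ c) p fun s hs => by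
    obtain ⟨x, hx⟩ := hp s hs
    refine ⟨ι x, fun φ hφ => ?_⟩
    have := (hel _ φ (Sum.elim c fun _ => x)).2 (hx φ hφ)
    rwa [Sum.comp_elim] at this
  obtain ⟨y', hy'⟩ := hwitM k c y
  have key : ∀ z : B, (Fin.snoc (α := fun _ => B) (ι ∘ c) z : Fin (k + 1) → B) ∘
      Sum.elim Fin.castSucc (fun _ : Fin 1 => Fin.last k) = Sum.elim (ι ∘ c) fun _ => z := by
    intro z
    ext i
    cases i <;> simp
  refine ⟨y', fun φ hφ => (hel _ φ _).1 ?_⟩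
  have := hy' (φ.relabel (Sum.elim Fin.castSucc (fun _ : Fin 1 => Fin.last k)))
  rw [Formula.realize_relabel, Formula.realize_relabel, key, key] at this
  rw [Sum.comp_elim]
  exact this.2 (hy φ hφ)

end CountableModel

section BackAndForth

variable {M : Type} [L.Structure M]

variable (L) in
/-- A relation between two structures is elementary if related tuples satisfy the same formulas. -/
def IsElementaryRel (f : Set (M × N)) : Prop :=
  ∀ (α : Type) (s : α → M × N), (∀ i, s i ∈ f) → ∀ φ : L.Formula α,
    φ.Realize (fun i => (s i).1) ↔ φ.Realize (fun i => (s i).2)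

theorem IsElementaryRel.swap {f : Set (M × N)} (hf : IsElementaryRel L f) :
    IsElementaryRel L (Prod.swap ⁻¹' f) :=
  fun α s hs φ => (hf α (fun i => (s i).swap) hs φ).symm

theorem IsElementaryRel.exists_insert {f : Set (M × N)} (hf : IsElementaryRel L f)
    (hfin : f.Finite) (hN : IsSaturated L N) (a : M) :
    ∃ b : N, IsElementaryRel L (insert (a, b) f) := by
  have := hfin.to_subtype
  obtain ⟨k, ⟨e⟩⟩ := Finite.exists_equiv_fin f
  let c : Fin k → M × N := fun i => (e.symm i).1
  have hc : ∀ i, c i ∈ f := fun i => (e.symm i).2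
  obtain ⟨b, hb⟩ := hN k (fun i => (c i).2)
    {φ | φ.Realize (Sum.elim (fun i => (c i).1) fun _ => a)} fun s hs => by
      have h := (hf _ c hc ((Formula.iInf fun φ : s => φ.1).iExs (Fin 1))).1
      simp only [Formula.realize_iExs, Formula.realize_iInf, Subtype.forall] at h
      obtain ⟨x, hx⟩ := h ⟨fun _ => a, hs⟩
      refine ⟨x 0, fun φ hφ => ?_⟩
      convert! hx φ hφ using 2
      exact funext fun i => by rw [Subsingleton.elim i 0]
  have hb' : ∀ φ : L.Formula (Fin k ⊕ Fin 1),
      φ.Realize (Sum.elim (fun i => (c i).1) fun _ => a) ↔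
        φ.Realize (Sum.elim (fun i => (c i).2) fun _ => b) := fun φ =>
    ⟨hb φ, fun h => by
      by_contra hn
      exact hb φ.not hn h⟩
  refine ⟨b, fun α s hs φ => ?_⟩
  have hg : ∀ i, ∃ g : Fin k ⊕ Fin 1, (s i).1 = Sum.elim (fun i => (c i).1) (fun _ => a) g ∧
      (s i).2 = Sum.elim (fun i => (c i).2) (fun _ => b) g := fun i => by
    rcases hs i with h | h
    · exact ⟨Sum.inr 0, by simp [h], by simp [h]⟩
    · exact ⟨Sum.inl (e ⟨_, h⟩), by simp [c], by simp [c]⟩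
  choose g hg₁ hg₂ using hg
  rw [funext hg₁, funext hg₂]
  have := hb' (φ.relabel g)
  rwa [Formula.realize_relabel, Formula.realize_relabel] at this

/-- Countable saturated structures are isomorphic over a finite set of common parameters. -/
theorem exists_equiv_of_isSaturated [Countable M] [Countable N] (hM : IsSaturated L M)
    (hN : IsSaturated L N) {f : Set (M × N)} (hfin : f.Finite) (hf : IsElementaryRel L f) :
    ∃ e : M ≃[L] N, ∀ p ∈ f, e p.1 = p.2 := by
  let P := {f : Set (M × N) // f.Finite ∧ IsElementaryRel L f}
  have hforth : ∀ a : M, IsCofinal {g : P | ∃ b, (a, b) ∈ g.1} := fun a g => by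
    obtain ⟨b, hb⟩ := g.2.2.exists_insert g.2.1 hN a
    exact ⟨⟨_, g.2.1.insert _, hb⟩, ⟨b, Set.mem_insert _ _⟩, Set.subset_insert _ _⟩
  have hback : ∀ b : N, IsCofinal {g : P | ∃ a, (a, b) ∈ g.1} := fun b g => by
    obtain ⟨a, ha⟩ := g.2.2.swap.exists_insert (g.2.1.preimage Prod.swap_injective.injOn) hM b
    refine ⟨⟨insert (a, b) g.1, g.2.1.insert _, ?_⟩, ⟨a, Set.mem_insert _ _⟩,
      Set.subset_insert _ _⟩
    convert! ha.swap using 1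
    ext ⟨x, y⟩
    simp [and_comm]
  let D : M ⊕ N → Order.Cofinal P := Sum.elim (fun a => ⟨_, hforth a⟩) fun b => ⟨_, hback b⟩
  have : Encodable (M ⊕ N) := Encodable.ofCountable _
  let I := Order.idealOfCofinals ⟨f, hfin, hf⟩ D
  have hI : ∀ {α : Type} [Finite α] (s : α → M × N), (∀ i, ∃ g ∈ I, s i ∈ g.1) →
      ∃ g ∈ I, ∀ i, s i ∈ g.1 := fun {α} _ s hs => by
    choose g hgI hg using hs
    have := I.nonempty.to_subtype
    obtain ⟨h, hh⟩ := (directedOn_iff_directed.1 I.directed).finite_le fun i => ⟨g i, hgI i⟩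
    exact ⟨h.1, h.2, fun i => hh i (hg i)⟩
  have hex : ∀ a : M, ∃ b, ∃ g ∈ I, (a, b) ∈ g.1 := fun a => by
    obtain ⟨g, ⟨b, hb⟩, hg⟩ := Order.cofinal_meets_idealOfCofinals ⟨f, hfin, hf⟩ D (Sum.inl a)
    exact ⟨b, g, hg, hb⟩
  choose e he using hex
  have hel : ∀ (α : Type) [Finite α] (s : α → M × N), (∀ i, ∃ g ∈ I, s i ∈ g.1) →
      ∀ φ : L.Formula α, φ.Realize (fun i => (s i).1) ↔ φ.Realize (fun i => (s i).2) :=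
    fun α _ s hs φ => by
      obtain ⟨g, -, hg⟩ := hI s hs
      exact g.2.2 α s hg φ
  have huniq : ∀ a b, (∃ g ∈ I, (a, b) ∈ g.1) → e a = b := fun a b hab => by
    have := hel (Fin 2) ![(a, e a), (a, b)] (by simpa [Fin.forall_fin_two] using ⟨he a, hab⟩)
      (Term.equal (Term.var 0) (Term.var 1))
    simpa using this
  let ε : M ↪ₑ[L] N := ⟨e, fun n φ v => (hel (Fin n) (fun i => (v i, e (v i))) (fun i => he _) φ).symm⟩
  have hsurj : Function.Surjective e := fun b => by
    obtain ⟨g, ⟨a, ha⟩, hg⟩ := Order.cofinal_meets_idealOfCofinals ⟨f, hfin, hf⟩ D (Sum.inr b)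
    exact ⟨a, huniq a b ⟨g, hg, ha⟩⟩
  refine ⟨⟨Equiv.ofBijective e ⟨ε.injective, hsurj⟩, fun f x => ε.map_fun f x,
    fun R x => ε.map_rel R x⟩, fun p hp => huniq p.1 p.2 ⟨_, Order.mem_idealOfCofinals _ _, hp⟩⟩

end BackAndForth

section Density

theorem realize_sentence_iff_of_realize {K : FirstOrder.Language.{0,0}} {A B : Type} [K.Structure A]
    [K.Structure B] {j : A → B}
    (hj : ∀ (α : Type) (φ : K.Formula α) (v : α → A), φ.Realize (j ∘ v) ↔ φ.Realize v)
    (φ : K.Sentence) : B ⊨ φ ↔ A ⊨ φ := by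
  have := hj Empty φ default
  rwa [Subsingleton.elim (j ∘ default) default] at this

theorem model_iff_of_realize {K : FirstOrder.Language.{0,0}} {A B : Type} [K.Structure A]
    [K.Structure B] {j : A → B}
    (hj : ∀ (α : Type) (φ : K.Formula α) (v : α → A), φ.Realize (j ∘ v) ↔ φ.Realize v)
    (T : K.Theory) : B ⊨ T ↔ A ⊨ T := by
  simp only [Theory.model_iff, realize_sentence_iff_of_realize hj]

theorem realize_comp_iff_of_isQF {K : FirstOrder.Language.{0,0}} {A B : Type} [K.Structure A]
    [K.Structure B] (ι : A ↪[K] B) {α : Type} {φ : K.Formula α} (hφ : φ.IsQF) (v : α → A) :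
    φ.Realize (ι ∘ v) ↔ φ.Realize v := by
  have := hφ.realize_embedding ι (v := v) (xs := default)
  rwa [Subsingleton.elim (ι ∘ default) default] at this

/-- A model of a theory universal modulo `T` passes it on to substructures that are models
of `T`. -/
theorem model_of_embedding {T : L.Theory} {T₀ : (L.sum L').Theory}
    (huniv : UniversalTheoryModulo L L' T T₀) {A B : Type} [L.Structure A] [L'.Structure A]
    [L.Structure B] [L'.Structure B] (ι : A ↪[L.sum L'] B) (hA : A ⊨ T) (hB : B ⊨ T)
    (hB₀ : B ⊨ T₀) : A ⊨ T₀ := by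
  refine ⟨fun φ hφ => ?_⟩
  obtain ⟨ψ, hψ, h⟩ := huniv φ hφ
  refine (h A hA).2 (hψ.realize_embedding ι ?_)
  rw [Subsingleton.elim (ι ∘ default) default, Subsingleton.elim (ι ∘ default) default]
  exact (h B hB).1 (hB₀.realize_of_mem φ hφ)

/-- The expansion induced by an isomorphism of `L`-structures. -/
theorem exists_expansion_equiv {M : Type} [L.Structure M] [L'.Structure M] (e : M ≃[L] N) :
    ∃ (_ : L'.Structure N) (E : M ≃[L.sum L'] N), ∀ x, E x = e x := by
  let := e.toEquiv.inducedStructure (L := L')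
  let E' := e.toEquiv.inducedStructureEquiv (L := L')
  refine ⟨this, ⟨e.toEquiv, ?_, ?_⟩, fun _ => rfl⟩
  · rintro n (f | f) x
    · exact e.map_fun f x
    · exact E'.map_fun f x
  · rintro n (R | R) x
    · exact e.map_rel R x
    · exact E'.map_rel R x

/-- A finitely satisfiable partial type consisting of `L`-formulas and one quantifier-free formula
is realized after changing the expansion away from finitely many parameters. -/
theorem exists_expansion_realizes {T : L.Theory} {T₀ : (L.sum L').Theory} [Countable N]
    [Nonempty N] [N ⊨ T] (hsmall : IsSmall L T) (hsat : IsSaturated L N)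
    [Finite (Σ i, L'.Functions i)] [Finite (Σ i, L'.Relations i)]
    (huniv : UniversalTheoryModulo L L' T T₀) [i₀ : L'.Structure N] (hT₀ : N ⊨ T₀)
    {D : Set N} (hD : D.Finite) {α β : Type} [Countable α] [Countable β] (c : α → N)
    (hc : ∀ i, c i ∈ D) (p : Set (L.Formula (α ⊕ β))) (ψ : (L.sum L').Formula (α ⊕ β))
    (hψ : ψ.IsQF)
    (hp : ∀ s : Finset (L.Formula (α ⊕ β)), ↑s ⊆ p → ∃ x : β → N, ψ.Realize (Sum.elim c x) ∧
      ∀ χ ∈ s, χ.Realize (Sum.elim c x)) :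
    ∃ i' : L'.Structure N, @Theory.Model _ N (@sumStructure L L' N _ i') T₀ ∧
      (∀ (γ : Type) (φ : (L.sum L').Formula γ) (v : γ → N), φ.IsQF → (∀ i, v i ∈ D) →
        (@Formula.Realize _ N (@sumStructure L L' N _ i') _ φ v ↔
          @Formula.Realize _ N (@sumStructure L L' N _ i₀) _ φ v)) ∧
      ∃ x : β → N, @Formula.Realize _ N (@sumStructure L L' N _ i') _ ψ (Sum.elim c x) ∧
        ∀ χ ∈ p, χ.Realize (Sum.elim c x) := by
  classical
  have hNT : N ⊨ T := inferInstance
  obtain ⟨B, str, j, hj, hsatB⟩ := exists_saturated_extension (K := L.sum L') (A := N)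
    fun γ _ Q => by
      obtain ⟨S, hSQ, hS, h⟩ := exists_countable_cover (N := N) (L' := L') hsmall γ Q
      exact ⟨S, hSQ, hS, fun φ hφ => (h φ hφ).imp fun φ₀ h => ⟨h.1, h.2 _⟩⟩
  obtain ⟨i, i', rfl⟩ := exists_eq_sumStructure str
  have hjL : ∀ (γ : Type) (φ : L.Formula γ) (v : γ → N), φ.Realize (j ∘ v) ↔ φ.Realize v := by
    intro γ φ v
    have := hj γ ((LHom.sumInl : L →ᴸ L.sum L').onFormula φ) v
    rwa [LHom.realize_onFormula, LHom.realize_onFormula] at this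
  have hBT : B ⊨ T := (model_iff_of_realize hjL T).2 hNT
  have : Nonempty B := ⟨j (Classical.arbitrary N)⟩
  have hsatBL : IsSaturated L B := by
    intro k d q hq
    obtain ⟨y, hy⟩ := hsatB (Fin k) (Fin 1) d
      ((LHom.sumInl : L →ᴸ L.sum L').onFormula '' q) fun s hs => by
        obtain ⟨t, ht, rfl⟩ := Finset.subset_set_image_iff.1 hs
        obtain ⟨y, hy⟩ := hq t ht
        refine ⟨fun _ => y, fun φ hφ => ?_⟩
        obtain ⟨χ, hχ, rfl⟩ := Finset.mem_image.1 hφ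
        exact (LHom.realize_onFormula _ _).2 (hy χ hχ)
    refine ⟨y 0, fun φ hφ => ?_⟩
    have := (LHom.realize_onFormula _ _).1 (hy _ (Set.mem_image_of_mem _ hφ))
    rwa [show (fun _ => y 0) = y from funext fun i => by rw [Subsingleton.elim i 0] ]
  obtain ⟨x, hx⟩ := hsatB α β (j ∘ c)
    (insert ψ ((LHom.sumInl : L →ᴸ L.sum L').onFormula '' p)) fun s hs => by
      have hs' : ↑(s.erase ψ) ⊆ (LHom.sumInl : L →ᴸ L.sum L').onFormula '' p := by
        simpa [Set.sdiff_subset_iff] using hs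
      obtain ⟨t, ht, hts⟩ := Finset.subset_set_image_iff.1 hs'
      obtain ⟨x, hxψ, hx⟩ := hp t ht
      refine ⟨j ∘ x, fun φ hφ => ?_⟩
      rw [← Sum.comp_elim, hj]
      by_cases h : φ = ψ
      · rwa [h]
      · have : φ ∈ s.erase ψ := Finset.mem_erase.2 ⟨h, hφ⟩
        rw [← hts] at this
        obtain ⟨χ, hχ, rfl⟩ := Finset.mem_image.1 this
        exact (LHom.realize_onFormula _ _).2 (hx χ hχ)
  obtain ⟨M, iM, iM', ι, hM, hsM, hel, hsatM⟩ := exists_countable_saturated_submodel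
    (L := L) (L' := L') (B := B)
    (fun k => (countable_types hsmall (Fin k)).mono fun t ⟨v, ht⟩ =>
      ⟨B, i, inferInstance, hBT, v, ht⟩) hsatBL
    ((Set.countable_range j).union (Set.countable_range x))
  have hMT : M ⊨ T := (model_iff_of_realize hel T).1 hBT
  have hMT₀ : M ⊨ T₀ := model_of_embedding huniv ι hMT hBT ((model_iff_of_realize hj T₀).2 hT₀)
  choose j' hj' using fun a => hsM (Or.inl ⟨a, rfl⟩ : j a ∈ _)
  choose x' hx' using fun b => hsM (Or.inr ⟨b, rfl⟩ : x b ∈ _)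
  have hιj : ∀ {γ : Type} (v : γ → N), ι ∘ j' ∘ v = j ∘ v := fun v => funext fun i => hj' _
  obtain ⟨e, he⟩ := exists_equiv_of_isSaturated hsatM hsat
    (hD.image fun d => (j' d, d)) fun γ v hv φ => by
      have h₁ : (fun i => (v i).1) = j' ∘ fun i => (v i).2 := by
        ext i
        obtain ⟨d, -, h⟩ := hv i
        simp [← h]
      rw [h₁, ← hel, hιj, hjL]
  have he' : ∀ {γ : Type} (v : γ → N), (∀ i, v i ∈ D) → e ∘ j' ∘ v = v := fun v hv =>
    funext fun i => he _ ⟨v i, hv i, rfl⟩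
  obtain ⟨τ, E, hE⟩ := exists_expansion_equiv (L' := L') e
  have hEe : (E : M → N) = e := funext hE
  refine ⟨τ, StrongHomClass.theory_model E, fun γ φ v hφ hv => ?_, e ∘ x', ?_, fun χ hχ => ?_⟩
  · rw [← hj, ← hιj, realize_comp_iff_of_isQF ι hφ, ← StrongHomClass.realize_formula E, hEe,
      he' v hv]
  · have : Sum.elim c (e ∘ x') = E ∘ Sum.elim (j' ∘ c) x' := by
      rw [hEe, Sum.comp_elim, he' c hc]
    rw [this, StrongHomClass.realize_formula E, ← realize_comp_iff_of_isQF ι hψ, Sum.comp_elim,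
      hιj, show ι ∘ x' = x from funext hx']
    exact hx ψ (Set.mem_insert _ _)
  · have : Sum.elim c (e ∘ x') = e ∘ Sum.elim (j' ∘ c) x' := by
      rw [Sum.comp_elim, he' c hc]
    rw [this, StrongHomClass.realize_formula e, ← hel, Sum.comp_elim,
      hιj, show ι ∘ x' = x from funext hx']
    exact (LHom.realize_onFormula _ _).1
      (hx _ (Set.mem_insert_of_mem _ (Set.mem_image_of_mem _ hχ)))

end Density

section Residual

open TopologicalSpace

/-- The expansions in `Exp(N, T₀)` realizing `ψ` together with the `L`-formulas in `t` over `c`. -/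
def realizingSet (L L' : FirstOrder.Language.{0,0}) (N : Type) [L.Structure N]
    (T₀ : (L.sum L').Theory) {α β : Type} (c : α → N) (t : Set (L.Formula (α ⊕ β)))
    (ψ : (L.sum L').Formula (α ⊕ β)) : Set (ExpSet L L' N T₀) :=
  {σ | ∃ x : β → N, @Formula.Realize _ N σ.1.str0 _ ψ (Sum.elim c x) ∧
    ∀ χ ∈ t, χ.Realize (Sum.elim c x)}

theorem isOpen_setOf_realize {α : Type} [Finite α] {φ : (L.sum L').Formula α} (hφ : φ.IsQF)
    (v : α → N) : IsOpen {σ : Expansions L L' N | @Formula.Realize _ N σ.str0 _ φ v} := by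
  obtain ⟨n, ⟨e⟩⟩ := Finite.exists_equiv_fin α
  refine isOpen_generateFrom_of_mem ⟨n, φ.relabel e, v ∘ e.symm, hφ.relabel _, ?_⟩
  ext σ
  let := σ.str0
  have h := Formula.realize_relabel (M := N) (φ := φ) (g := e) (v := v ∘ e.symm)
  rw [Function.comp_assoc, Equiv.symm_comp_self, Function.comp_id] at h
  exact h.symm

theorem isOpen_realizingSet {T₀ : (L.sum L').Theory} {α β : Type} [Finite α] [Finite β]
    (c : α → N) (t : Set (L.Formula (α ⊕ β))) {ψ : (L.sum L').Formula (α ⊕ β)} (hψ : ψ.IsQF) :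
    IsOpen (realizingSet L L' N T₀ c t ψ) := by
  have : realizingSet L L' N T₀ c t ψ = ⋃ x ∈ {x : β → N | ∀ χ ∈ t, χ.Realize (Sum.elim c x)},
      Subtype.val ⁻¹' {σ : Expansions L L' N | @Formula.Realize _ N σ.str0 _ ψ (Sum.elim c x)} := by
    ext σ
    simp [realizingSet, and_comm]
  rw [this]
  exact isOpen_biUnion fun x _ => (isOpen_setOf_realize hψ _).preimage continuous_subtype_val

theorem mem_closure_realizingSet {T : L.Theory} {T₀ : (L.sum L').Theory} [Countable N]
    [Nonempty N] [N ⊨ T] (hsmall : IsSmall L T) (hsat : IsSaturated L N)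
    [Finite (Σ i, L'.Functions i)] [Finite (Σ i, L'.Relations i)]
    (huniv : UniversalTheoryModulo L L' T T₀) (σ : ExpSet L L' N T₀)
    {α β : Type} [Finite α] [Finite β] (c : α → N) (t : Set (L.Formula (α ⊕ β)))
    {ψ : (L.sum L').Formula (α ⊕ β)} (hψ : ψ.IsQF)
    (ht : ∀ s : Finset (L.Formula (α ⊕ β)), ↑s ⊆ t → ∃ x : β → N,
      @Formula.Realize _ N σ.1.str0 _ ψ (Sum.elim c x) ∧ ∀ χ ∈ s, χ.Realize (Sum.elim c x)) :
    σ ∈ closure (realizingSet L L' N T₀ c t ψ) := by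
  rw [mem_closure_iff]
  rintro _ ⟨U, hU, rfl⟩ hσU
  obtain ⟨_, ⟨F, ⟨hFfin, hF⟩, rfl⟩, hσF, hFU⟩ :=
    (isTopologicalBasis_of_subbasis (α := Expansions L L' N) rfl).exists_subset_of_mem_open
      (Set.mem_preimage.1 hσU) hU
  choose n φ d hφ hd using fun s : F => hF s.2
  have := hFfin.to_subtype
  let D : Set N := Set.range c ∪ ⋃ s : F, Set.range (d s)
  have hD : D.Finite := (Set.finite_range c).union
    (Set.finite_iUnion fun s => Set.finite_range (d s))
  obtain ⟨τ, hτ, hτD, hx⟩ := exists_expansion_realizes hsmall hsat huniv (i₀ := σ.1.str) σ.2 hD c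
    (fun i => Or.inl ⟨i, rfl⟩) t ψ hψ ht
  refine ⟨⟨τ, hτ⟩, hFU fun s hs => ?_, hx⟩
  have hσs := hσF s hs
  rw [show s = _ from hd ⟨s, hs⟩] at hσs ⊢
  exact (hτD _ _ _ (hφ ⟨s, hs⟩) fun i => Or.inr (Set.mem_iUnion.2 ⟨_, i, rfl⟩)).2 hσs

/-- A type consistent with `ψ` extends to a type of an ultrafilter consistent with `ψ`. -/
theorem exists_ultrafilter_type {α β : Type} (c : α → N) (p : Set (L.Formula (α ⊕ β)))
    (A : Set (β → N)) (hp : ∀ s : Finset (L.Formula (α ⊕ β)), ↑s ⊆ p → ∃ x ∈ A,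
      ∀ χ ∈ s, χ.Realize (Sum.elim c x)) :
    ∃ u : Ultrafilter (α ⊕ β → N),
      (∀ χ ∈ p, ∀ᶠ v in (u : Filter (α ⊕ β → N)), χ.Realize v) ∧
      ∀ s : Finset (L.Formula (α ⊕ β)),
        (∀ χ ∈ s, ∀ᶠ v in (u : Filter (α ⊕ β → N)), χ.Realize v) →
        ∃ x ∈ A, ∀ χ ∈ s, χ.Realize (Sum.elim c x) := by
  classical
  let R : {s : Finset (L.Formula (α ⊕ β)) // ↑s ⊆ p} → Set (β → N) :=
    fun s => {x | x ∈ A ∧ ∀ χ ∈ s.1, χ.Realize (Sum.elim c x)}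
  let f : Filter (β → N) := ⨅ s, Filter.principal (R s)
  have : Nonempty {s : Finset (L.Formula (α ⊕ β)) // ↑s ⊆ p} := ⟨∅, by simp⟩
  have hf : f.NeBot := by
    refine Filter.iInf_neBot_of_directed' (fun s t => ⟨⟨s.1 ∪ t.1, by simp [s.2, t.2]⟩, ?_, ?_⟩)
      fun s => Filter.principal_neBot_iff.2 (hp s.1 s.2)
    · exact Filter.principal_mono.2 fun x hx => ⟨hx.1, fun χ h => hx.2 χ (by simp [h])⟩
    · exact Filter.principal_mono.2 fun x hx => ⟨hx.1, fun χ h => hx.2 χ (by simp [h])⟩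
  let u := Ultrafilter.of f
  have hu : ∀ s, ∀ᶠ x in (u : Filter (β → N)), x ∈ R s := fun s =>
    Ultrafilter.of_le f (Filter.mem_iInf_of_mem s (Filter.mem_principal_self _))
  refine ⟨u.map (Sum.elim c), fun χ hχ => ?_, fun s hs => ?_⟩
  · rw [Ultrafilter.coe_map, Filter.eventually_map]
    exact (hu ⟨{χ}, by simpa using hχ⟩).mono fun x hx => hx.2 χ (by simp)
  · simp only [Ultrafilter.coe_map, Filter.eventually_map] at hs
    exact (((hu ⟨∅, by simp⟩).mono fun x hx => hx.1).and
      ((Filter.eventually_all_finset s).2 hs)).exists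

theorem isSmooth_of_isEmpty [IsEmpty N] (σ : Expansions L L' N) : σ.IsSmooth := by
  intro k n c p ψ _ hp
  obtain ⟨x, hx, -⟩ := hp ∅ (by simp)
  refine ⟨x, hx, fun χ hχ => ?_⟩
  obtain ⟨y, -, hy⟩ := hp {χ} (by simpa using hχ)
  rw [Subsingleton.elim x y]
  exact hy χ (by simp)

end Residual

/-- The set of smooth expansions is comeagre in `Exp(N, T₀)`. -/
theorem statement4
    (T : L.Theory) (T₀ : (L.sum L').Theory)
    [Countable N] (hNT : N ⊨ T) (hTc : T.IsComplete) (hqe : HasQE L T)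
    (hsmall : IsSmall L T) (hsat : IsSaturated L N)
    [Finite (Σ i, L'.Functions i)] [Finite (Σ i, L'.Relations i)]
    (hTT₀ : (LHom.sumInl : L →ᴸ L.sum L').onTheory T ⊆ T₀)
    (huniv : UniversalTheoryModulo L L' T T₀) :
    {σ : ↥(ExpSet L L' N T₀) | (↑σ : Expansions L L' N).IsSmooth} ∈
      residual ↥(ExpSet L L' N T₀) := by
  rcases isEmpty_or_nonempty N with hN | hN
  · exact Filter.Eventually.of_forall fun σ => isSmooth_of_isEmpty _
  choose S hSQ hS hcov using fun k n => exists_countable_cover (N := N) (L' := L') hsmall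
    (Fin k ⊕ Fin n) {φ | φ.IsQF}
  have key : ∀ᶠ σ in residual (ExpSet L L' N T₀), ∀ (k n : ℕ) (c : Fin k → N),
      ∀ t ∈ {t : Set (L.Formula (Fin k ⊕ Fin n)) | ∃ u : Ultrafilter (Fin k ⊕ Fin n → N),
        t = {φ | ∀ᶠ v in (u : Filter (Fin k ⊕ Fin n → N)), φ.Realize v}},
      ∀ ψ ∈ S k n, σ ∈ closure (realizingSet L L' N T₀ c t ψ) →
        σ ∈ realizingSet L L' N T₀ c t ψ := by
    refine eventually_countable_forall.2 fun k => eventually_countable_forall.2 fun n =>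
      eventually_countable_forall.2 fun c =>
      (eventually_countable_ball (countable_ultrafilter_types hsmall _)).2 fun t _ =>
      (eventually_countable_ball (hS k n)).2 fun ψ hψ => ?_
    have hopen := isOpen_realizingSet (T₀ := T₀) c t (hSQ k n hψ)
    refine Filter.mem_of_superset (residual_of_dense_open
      (s := realizingSet L L' N T₀ c t ψ ∪ (closure (realizingSet L L' N T₀ c t ψ))ᶜ)
      (hopen.union isClosed_closure.isOpen_compl) ?_) fun σ hσ h => hσ.resolve_right (not_not.2 h)
    intro σ
    by_cases h : σ ∈ closure (realizingSet L L' N T₀ c t ψ)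
    · exact closure_mono Set.subset_union_left h
    · exact subset_closure (Or.inr h)
  filter_upwards [key] with σ hσ k n c p ψ hψ hp
  obtain ⟨u, hup, hu⟩ := exists_ultrafilter_type c p
    {x | @Formula.Realize _ N σ.1.str0 _ ψ (Sum.elim c x)} hp
  obtain ⟨ψ₀, hψ₀, h⟩ := hcov k n ψ hψ
  obtain ⟨x, hx, hxt⟩ := hσ k n c _ ⟨u, rfl⟩ ψ₀ hψ₀
    (mem_closure_realizingSet hsmall hsat huniv σ c _ (hSQ k n hψ₀) fun s hs =>
      (hu s hs).imp fun x hx => ⟨(h σ.1.str _).2 hx.1, hx.2⟩)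
  exact ⟨x, (h σ.1.str _).1 hx, fun χ hχ => hxt χ (hup χ hχ)⟩

end GenExp
end

section
/- If T is ω-categorical, then every expansion σ ∈ Exp(N, T₀) is smooth. -/
open FirstOrder FirstOrder.Language

namespace GenExp

variable {L L' : FirstOrder.Language.{0,0}} {N : Type} [L.Structure N]

section Isolation

/-- The tuple `v` extended by the single entry `b`. -/
abbrev extend {α : Type} (v : α → N) (b : N) : α ⊕ Fin 1 → N :=
  Sum.elim v fun _ => b

variable (L) in
/-- The parameter-free type of the tuple `v` is isolated: among the definable sets containing `v`
there is a least one. -/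
def IsIsolated {α : Type} (v : α → N) : Prop :=
  ∃ S : Set (α → N), (∅ : Set N).Definable L S ∧ v ∈ S ∧
    ∀ D : Set (α → N), (∅ : Set N).Definable L D → v ∈ D → S ⊆ D

variable (L) in
/-- The type of `b` over the tuple `v` is isolated. -/
def IsIsolatedOver {α : Type} (v : α → N) (b : N) : Prop :=
  ∃ E : Set (α ⊕ Fin 1 → N), (∅ : Set N).Definable L E ∧ extend v b ∈ E ∧
    ∀ D : Set (α ⊕ Fin 1 → N), (∅ : Set N).Definable L D → extend v b ∈ D →
      ∀ b', extend v b' ∈ E → extend v b' ∈ D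

variable (L N) in
/-- Finitely many `α`-tuples realize all parameter-free types of `α`-tuples of `N`. -/
def HasFinitelyManyTypes (α : Type) : Prop :=
  ∃ R : Set (α → N), R.Finite ∧ ∀ v, ∃ w ∈ R, ∀ D : Set (α → N),
    (∅ : Set N).Definable L D → v ∈ D → w ∈ D

theorem extend_eq {α : Type} (u : α → N) (z : Fin 1 → N) : extend u (z 0) = Sum.elim u z := by
  have : (fun _ => z 0) = z := funext fun i => by rw [Subsingleton.elim i 0]
  rw [extend, this]

/-- Saturation for families of definable sets over a finite tuple. -/
theorem IsSaturated.exists_mem (hsat : IsSaturated L N) {α ι : Type} [Finite α] (c : α → N)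
    (F : ι → Set (α ⊕ Fin 1 → N)) (hF : ∀ i, (∅ : Set N).Definable L (F i))
    (h : ∀ t : Finset ι, ∃ x, ∀ i ∈ t, extend c x ∈ F i) :
    ∃ x, ∀ i, extend c x ∈ F i := by
  classical
  obtain ⟨k, ⟨e⟩⟩ := Finite.exists_equiv_fin α
  choose φ hφ using fun i => Set.empty_definable_iff.1 (hF i)
  let ψ : ι → L.Formula (Fin k ⊕ Fin 1) := fun i => (φ i).relabel (Sum.map e id)
  have key : ∀ i x, (ψ i).Realize (Sum.elim (c ∘ e.symm) fun _ => x) ↔ extend c x ∈ F i := by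
    intro i x
    rw [hφ i, Formula.realize_relabel]
    have : (Sum.elim (c ∘ e.symm) fun _ => x) ∘ Sum.map e id = extend c x := by
      funext j
      rcases j with j | j <;> simp
    rw [this]
    rfl
  obtain ⟨x, hx⟩ := hsat k (c ∘ e.symm) (Set.range ψ) fun s hs => by
    choose g hg using fun χ : s => hs χ.2
    obtain ⟨x, hx⟩ := h (s.attach.image g)
    refine ⟨x, fun χ hχ => ?_⟩
    have hψ : ψ (g ⟨χ, hχ⟩) = χ := hg ⟨χ, hχ⟩
    rw [← hψ, key]
    exact hx _ (Finset.mem_image_of_mem _ (Finset.mem_attach _ _))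
  exact ⟨x, fun i => (key i x).1 (hx _ ⟨i, rfl⟩)⟩

/-- In a countable saturated structure, isolated types over a finite tuple are dense. -/
theorem exists_isIsolatedOver [Countable N] (hsat : IsSaturated L N) {α : Type} [Finite α]
    (c : α → N) (D : Set (α ⊕ Fin 1 → N)) (hD : (∅ : Set N).Definable L D) (a : N)
    (ha : extend c a ∈ D) : ∃ b, extend c b ∈ D ∧ IsIsolatedOver L c b := by
  by_contra! hcon
  let P := {S : Set (α ⊕ Fin 1 → N) //
    (∅ : Set N).Definable L S ∧ (∃ b, extend c b ∈ S) ∧ S ⊆ D}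
  have step : ∀ (S : P) (b : N), ∃ S' : P, S'.1 ⊆ S.1 ∧ extend c b ∉ S'.1 := by
    rintro ⟨S, hS, hne, hSD⟩ b
    by_cases hb : extend c b ∈ S
    · by_contra! hno
      refine hcon b (hSD hb) ⟨S, hS, hb, fun G hG hbG b' hb' => ?_⟩
      by_contra hb'G
      exact (hno ⟨S \ G, hS.sdiff hG, ⟨b', hb', hb'G⟩, Set.sdiff_subset.trans hSD⟩
        Set.sdiff_subset).2 hbG
    · exact ⟨⟨S, hS, hne, hSD⟩, subset_rfl, hb⟩
  choose next hnext_sub hnext_notMem using step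
  have : Nonempty N := ⟨a⟩
  obtain ⟨e, he⟩ := exists_surjective_nat N
  let seq : ℕ → P := fun n =>
    Nat.rec ⟨D, hD, ⟨a, ha⟩, subset_rfl⟩ (fun n S => next S (e n)) n
  have hanti : Antitone fun n => (seq n).1 := antitone_nat_of_succ_le fun n => hnext_sub _ _
  obtain ⟨x, hx⟩ := hsat.exists_mem c (fun n => (seq n).1) (fun n => (seq n).2.1) fun t => by
    obtain ⟨b, hb⟩ := (seq (t.sup id)).2.2.1
    exact ⟨b, fun i hi => hanti (Finset.le_sup (f := id) hi) hb⟩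
  obtain ⟨n, rfl⟩ := he x
  exact hnext_notMem (seq n) (e n) (hx (n + 1))

theorem IsIsolated.extend {α : Type} {v : α → N} (hv : IsIsolated L v) {b : N}
    (hb : IsIsolatedOver L v b) : IsIsolated L (extend v b) := by
  obtain ⟨A, hA, hvA, hAmin⟩ := hv
  obtain ⟨E, hE, hbE, hEmin⟩ := hb
  refine ⟨E ∩ (fun g => g ∘ Sum.inl) ⁻¹' A, hE.inter (hA.preimage_comp _), ⟨hbE, hvA⟩, ?_⟩
  rintro G hG hbG w ⟨hwE, hwA⟩
  have hsub := hAmin _ ((hE.compl.union hG).forall_of_finite) (fun z => by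
    rw [← extend_eq]
    by_cases hz : GenExp.extend v (z 0) ∈ E
    · exact Or.inr (hEmin G hG hbG _ hz)
    · exact Or.inl hz)
  have hw := hsub hwA (w ∘ Sum.inr)
  rw [Sum.elim_comp_inl_inr] at hw
  exact hw.resolve_left fun h => h hwE

theorem IsIsolated.comp {α β : Type} [Finite α] [Finite β] {v : α → N} (hv : IsIsolated L v)
    (f : β → α) : IsIsolated L (v ∘ f) := by
  obtain ⟨A, hA, hvA, hAmin⟩ := hv
  refine ⟨(fun g => g ∘ f) '' A, hA.image_comp f, ⟨v, hvA, rfl⟩, fun G hG hvG => ?_⟩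
  rw [Set.image_subset_iff]
  exact hAmin _ (hG.preimage_comp f) hvG

theorem IsIsolated.of_forall_mem_range {α β : Type} [Finite α] [Finite β] {v : α → N}
    (hv : IsIsolated L v) {w : β → N} (hw : ∀ j, w j ∈ Set.range v) : IsIsolated L w := by
  choose f hf using hw
  have : w = v ∘ f := funext fun j => (hf j).symm
  exact this ▸ hv.comp f

theorem isIsolated_of_isEmpty {α : Type} [IsEmpty α] (v : α → N) : IsIsolated L v :=
  ⟨Set.univ, Set.definable_univ, Set.mem_univ _, fun _ _ hD w _ => Subsingleton.elim v w ▸ hD⟩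

/-- An elementary embedding reflects isolation. -/
theorem IsIsolated.of_elementaryEmbedding (h : N ↪ₑ[L] N) {α : Type} {v : α → N}
    (hv : IsIsolated L (h ∘ v)) : IsIsolated L v := by
  obtain ⟨S, hS, hvS, hmin⟩ := hv
  have key : ∀ D : Set (α → N), (∅ : Set N).Definable L D → ∀ w, h ∘ w ∈ D ↔ w ∈ D := by
    intro D hD w
    obtain ⟨φ, rfl⟩ := Set.empty_definable_iff.1 hD
    exact h.map_formula φ w
  refine ⟨S, hS, (key S hS v).1 hvS, fun D hD hvD w hw => ?_⟩
  exact (key D hD w).1 (hmin D hD ((key D hD v).2 hvD) ((key S hS w).2 hw))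

/-- A set which meets every nonempty set definable over one of its finite subsets meets all
definable sets. -/
theorem meetsDefinable_of_finset {A : Set N}
    (h : ∀ F : Finset N, ↑F ⊆ A → ∀ D : Set (F ⊕ Fin 1 → N), (∅ : Set N).Definable L D →
      ∀ a, extend (fun x : F => x.1) a ∈ D → ∃ b ∈ A, extend (fun x : F => x.1) b ∈ D) :
    L.MeetsDefinable A := by
  rintro D ⟨a, ha⟩ hD
  obtain ⟨F, hFA, hF⟩ := Set.definable_iff_finitely_definable.1 hD
  obtain ⟨φ, hφ⟩ := Set.definable_iff_exists_formula_sum.1 hF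
  have key : ∀ b : N, b ∈ D ↔ extend (fun x : F => x.1) b ∈ Set.ofPred φ.Realize :=
    fun b => Set.ext_iff.1 hφ fun _ => b
  obtain ⟨b, hbA, hb⟩ := h F hFA _ (Set.empty_definable_iff.2 ⟨φ, rfl⟩) a ((key a).1 ha)
  exact ⟨b, (key b).2 hb, hbA⟩

/-- A countable saturated structure has an elementary substructure which is atomic in it. -/
theorem exists_atomic_elementarySubstructure [Countable N] (hsat : IsSaturated L N) :
    ∃ M : L.ElementarySubstructure N, ∀ (α : Type) [Finite α] (v : α → M),
      IsIsolated L fun i => (v i : N) := by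
  classical
  let P := {F : Finset N // IsIsolated L fun x : F => x.1}
  let Good (F : P) (X : Finset N) (b : N) : Prop :=
    ∀ G : P, F ≤ G → X ⊆ G.1 → IsIsolatedOver L (fun x : X => x.1) b →
      ∃ j ∈ F.1, ∀ D : Set (X ⊕ Fin 1 → N), (∅ : Set N).Definable L D →
        extend (fun x : X => x.1) b ∈ D → extend (fun x : X => x.1) j ∈ D
  have cofinal : ∀ (X : Finset N) (b : N), IsCofinal {F : P | Good F X b} := by
    intro X b F
    by_cases hF : (∃ G : P, F ≤ G ∧ X ⊆ G.1) ∧ IsIsolatedOver L (fun x : X => x.1) b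
    · obtain ⟨⟨G, hFG, hXG⟩, E, hE, hbE, hEmin⟩ := hF
      let f : X ⊕ Fin 1 → G.1 ⊕ Fin 1 := Sum.map (fun x => ⟨x.1, hXG x.2⟩) id
      have hf : ∀ y, extend (fun x : G.1 => x.1) y ∘ f = extend (fun x : X => x.1) y := by
        intro y
        funext i
        rcases i with i | i <;> rfl
      obtain ⟨j, hj, hjG⟩ := exists_isIsolatedOver hsat (fun x : G.1 => x.1)
        ((fun g => g ∘ f) ⁻¹' E) (hE.preimage_comp f) b (by
          rw [Set.mem_preimage, hf]
          exact hbE)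
      rw [Set.mem_preimage, hf] at hj
      refine ⟨⟨insert j G.1, (G.2.extend hjG).of_forall_mem_range ?_⟩, ?_, ?_⟩
      · rintro ⟨x, hx⟩
        rcases Finset.mem_insert.1 hx with rfl | hx
        · exact ⟨Sum.inr 0, rfl⟩
        · exact ⟨Sum.inl ⟨x, hx⟩, rfl⟩
      · exact fun _ _ _ _ => ⟨j, Finset.mem_insert_self _ _, fun D hD hbD => hEmin D hD hbD j hj⟩
      · exact fun x hx => Finset.mem_insert_of_mem (hFG hx)
    · exact ⟨F, fun G hFG hXG hb => (hF ⟨⟨G, hFG, hXG⟩, hb⟩).elim, le_rfl⟩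
  have : Encodable (Finset N × N) := Encodable.ofCountable _
  let 𝒟 : Finset N × N → Order.Cofinal P := fun i => ⟨_, cofinal i.1 i.2⟩
  let J := Order.idealOfCofinals (⟨∅, isIsolated_of_isEmpty _⟩ : P) 𝒟
  let A : Set N := {a | ∃ F ∈ J, a ∈ F.1}
  have hA : ∀ X : Finset N, ↑X ⊆ A → ∃ F ∈ J, X ⊆ F.1 := by
    intro X
    induction X using Finset.induction_on with
    | empty => exact fun _ => ⟨_, Order.mem_idealOfCofinals _ _, Finset.empty_subset _⟩
    | insert a X _ ih =>
      intro hX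
      rw [Finset.coe_insert, Set.insert_subset_iff] at hX
      obtain ⟨⟨F, hF, haF⟩, hXA⟩ := hX
      obtain ⟨G, hG, hXG⟩ := ih hXA
      obtain ⟨H, hH, hFH, hGH⟩ := J.directed F hF G hG
      exact ⟨H, hH, Finset.insert_subset (hFH haF) (hXG.trans hGH)⟩
  have hmeets : L.MeetsDefinable A := by
    refine meetsDefinable_of_finset fun X hX D hD a ha => ?_
    obtain ⟨b, hbD, hb⟩ := exists_isIsolatedOver hsat _ D hD a ha
    obtain ⟨F, hFgood, hF⟩ :=
      Order.cofinal_meets_idealOfCofinals (⟨∅, isIsolated_of_isEmpty _⟩ : P) 𝒟 (X, b)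
    obtain ⟨G, hG, hXG⟩ := hA X hX
    obtain ⟨H, hH, hFH, hGH⟩ := J.directed F hF G hG
    obtain ⟨j, hj, hjD⟩ := hFgood H hFH (hXG.trans hGH) hb
    exact ⟨j, ⟨F, hF, hj⟩, hjD D hD hbD⟩
  refine ⟨hmeets.toElementarySubstructure, fun α _ v => ?_⟩
  have hv : ∀ i, (v i : N) ∈ A := fun i => by
    have hi : (v i : N) ∈ (Substructure.closure L A : Set N) := (v i).2
    rwa [hmeets.closure_eq_self] at hi
  obtain ⟨F, -, hF⟩ := hA (Set.finite_range fun i => (v i : N)).toFinset (by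
    rintro _ hx
    simp only [Set.Finite.coe_toFinset, Set.mem_range] at hx
    obtain ⟨i, rfl⟩ := hx
    exact hv i)
  refine F.2.of_forall_mem_range fun i => ⟨⟨v i, hF ?_⟩, rfl⟩
  simp

/-- In a countable infinite saturated model of an `ℵ₀`-categorical theory all finite tuples have
isolated types. -/
theorem isIsolated_of_categorical [Countable N] [Infinite N] (hsat : IsSaturated L N)
    (T : L.Theory) (hNT : N ⊨ T) (hcat : Cardinal.aleph0.Categorical T) {α : Type} [Finite α]
    (v : α → N) : IsIsolated L v := by
  obtain ⟨M, hM⟩ := exists_atomic_elementarySubstructure hsat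
  have : Infinite M := M.elementarilyEquivalent.infinite_iff.2 inferInstance
  have : Countable M := Subtype.val_injective.countable
  let N' := (Theory.ModelType.of T N)
  let M' := (Theory.ModelType.of T M)
  obtain ⟨g⟩ := hcat N'.ulift M'.ulift
    (Cardinal.mk_eq_aleph0 (ULift N)) (Cardinal.mk_eq_aleph0 (ULift M))
  let i₁ : N ≃[L] N'.ulift := Equiv.inducedStructureEquiv (Equiv.ulift.symm : N ≃ ULift N)
  let i₂ : M ≃[L] M'.ulift := Equiv.inducedStructureEquiv (Equiv.ulift.symm : M ≃ ULift M)
  let e : N ≃[L] M := (i₂.symm.comp g).comp i₁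
  exact IsIsolated.of_elementaryEmbedding (M.subtype.comp e.toElementaryEmbedding)
    (hM α fun i => e (v i))

theorem HasFinitelyManyTypes.of_equiv {α β : Type} (e : α ≃ β)
    (h : HasFinitelyManyTypes L N α) : HasFinitelyManyTypes L N β := by
  obtain ⟨R, hR, hRv⟩ := h
  refine ⟨(fun g => g ∘ e.symm) '' R, hR.image _, fun v => ?_⟩
  obtain ⟨w, hw, hwD⟩ := hRv (v ∘ e)
  refine ⟨_, ⟨w, hw, rfl⟩, fun D hD hvD => hwD _ (hD.preimage_comp e.symm) ?_⟩
  simpa [Function.comp_assoc] using hvD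

theorem HasFinitelyManyTypes.sum_fin_one (hsat : IsSaturated L N) {α : Type} [Finite α]
    (hiso : ∀ v : α ⊕ Fin 1 → N, IsIsolated L v) (h : HasFinitelyManyTypes L N α) :
    HasFinitelyManyTypes L N (α ⊕ Fin 1) := by
  obtain ⟨R, hR, hRv⟩ := h
  have hfib : ∀ w : α → N, ∃ t : Finset N, ∀ x, ∃ b ∈ t, ∀ D : Set (α ⊕ Fin 1 → N),
      (∅ : Set N).Definable L D → extend w x ∈ D → extend w b ∈ D := by
    intro w
    choose S hS hwS hmin using fun b => hiso (extend w b)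
    by_contra! hcon
    obtain ⟨x, hx⟩ := hsat.exists_mem w (fun b => (S b)ᶜ) (fun b => (hS b).compl) fun t => by
      obtain ⟨x, hx⟩ := hcon t
      refine ⟨x, fun b hb hxS => ?_⟩
      obtain ⟨D, hD, hxD, hbD⟩ := hx b hb
      exact hmin b Dᶜ hD.compl hbD hxS hxD
    exact hx x (hwS x)
  choose t ht using hfib
  refine ⟨⋃ w ∈ R, extend w '' (t w), hR.biUnion fun w _ => (t w).finite_toSet.image _, ?_⟩
  intro v
  obtain ⟨w, hw, hwD⟩ := hRv (v ∘ Sum.inl)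
  obtain ⟨S, hS, hvS, hmin⟩ := hiso v
  obtain ⟨z, hz⟩ := hwD _ hS.exists_of_finite ⟨v ∘ Sum.inr, by rwa [Sum.elim_comp_inl_inr]⟩
  rw [← extend_eq] at hz
  obtain ⟨b, hb, hbD⟩ := ht w (z 0)
  exact ⟨extend w b, Set.mem_biUnion hw ⟨b, hb, rfl⟩,
    fun D hD hvD => hbD D hD (hmin D hD hvD hz)⟩

theorem hasFinitelyManyTypes (hsat : IsSaturated L N)
    (hiso : ∀ (m : ℕ) (v : Fin m → N), IsIsolated L v) (α : Type) [Finite α] :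
    HasFinitelyManyTypes L N α := by
  obtain ⟨m, ⟨e⟩⟩ := Finite.exists_equiv_fin α
  suffices ∀ m, HasFinitelyManyTypes L N (Fin m) from (this m).of_equiv e.symm
  intro m
  induction m with
  | zero =>
    exact ⟨Set.univ, Set.finite_univ, fun v => ⟨v, Set.mem_univ _, fun _ _ h => h⟩⟩
  | succ m ih =>
    refine (ih.sum_fin_one hsat fun v => ?_).of_equiv finSumFinEquiv
    have := (hiso (m + 1) (v ∘ finSumFinEquiv.symm)).comp finSumFinEquiv
    simpa [Function.comp_assoc] using this

theorem HasFinitelyManyTypes.finite_definable {α : Type} (h : HasFinitelyManyTypes L N α) :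
    {D : Set (α → N) | (∅ : Set N).Definable L D}.Finite := by
  obtain ⟨R, hR, hRv⟩ := h
  refine Set.Finite.of_injOn (f := fun D => D ∩ R) (t := 𝒫 R)
    (fun D _ => Set.inter_subset_right) ?_ hR.finite_subsets
  have key : ∀ D D' : Set (α → N), (∅ : Set N).Definable L D → (∅ : Set N).Definable L D' →
      D ∩ R = D' ∩ R → D ⊆ D' := by
    intro D D' hD hD' heq v hv
    obtain ⟨w, hw, hwD⟩ := hRv v
    by_contra hv'
    have : w ∈ D' ∩ R := heq ▸ ⟨hwD D hD hv, hw⟩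
    exact hwD _ hD'.compl hv' this.1
  exact fun D hD D' hD' heq => (key D D' hD hD' heq).antisymm (key D' D hD' hD heq.symm)

/-- In a countable saturated model of an `ℵ₀`-categorical theory there are only finitely many
definable sets of finite tuples. -/
theorem finite_definable_of_categorical [Countable N] (hsat : IsSaturated L N)
    (T : L.Theory) (hNT : N ⊨ T) (hcat : Cardinal.aleph0.Categorical T) (α : Type) [Finite α] :
    {D : Set (α → N) | (∅ : Set N).Definable L D}.Finite := by
  rcases finite_or_infinite N with hN | hN
  · exact Set.toFinite _
  · exact (hasFinitelyManyTypes hsat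
      (fun m v => isIsolated_of_categorical hsat T hNT hcat v) α).finite_definable

end Isolation

/-- If `T` is ω-categorical, then every expansion in `Exp(N, T₀)` is
smooth. -/
theorem statement5
    (T : L.Theory) (T₀ : (L.sum L').Theory)
    [Countable N] (hNT : N ⊨ T) (hTc : T.IsComplete) (hqe : HasQE L T)
    (hsat : IsSaturated L N)
    [Finite (Σ i, L'.Functions i)] [Finite (Σ i, L'.Relations i)]
    (hTT₀ : (LHom.sumInl : L →ᴸ L.sum L').onTheory T ⊆ T₀)
    (huniv : UniversalTheoryModulo L L' T T₀)
    (hcat : Cardinal.aleph0.Categorical T) :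
    ∀ σ ∈ ExpSet L L' N T₀, σ.IsSmooth := by
  intro σ _ k n c p ψ _ hfin
  classical
  obtain ⟨s, hsp, hs⟩ : ∃ s : Finset (L.Formula (Fin k ⊕ Fin n)), ↑s ⊆ p ∧
      ∀ χ ∈ p, ∃ χ' ∈ s, ∀ v : Fin k ⊕ Fin n → N, χ'.Realize v → χ.Realize v := by
    have himage : ((fun χ : L.Formula (Fin k ⊕ Fin n) =>
        (Set.ofPred χ.Realize : Set (Fin k ⊕ Fin n → N))) '' p).Finite :=
      (finite_definable_of_categorical hsat T hNT hcat (Fin k ⊕ Fin n)).subset (by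
        rintro _ ⟨χ, -, rfl⟩
        exact Set.empty_definable_iff.2 ⟨χ, rfl⟩)
    obtain ⟨s, hsp, hs⟩ := Finset.subset_set_image_iff.1 himage.coe_toFinset.subset
    refine ⟨s, hsp, fun χ hχ => ?_⟩
    have hmem : (Set.ofPred χ.Realize : Set (Fin k ⊕ Fin n → N)) ∈ himage.toFinset :=
      himage.mem_toFinset.2 ⟨χ, hχ, rfl⟩
    rw [← hs] at hmem
    obtain ⟨χ', hχ', heq⟩ := Finset.mem_image.1 hmem
    exact ⟨χ', hχ', fun v hv => (Set.ext_iff.1 heq v).1 hv⟩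
  obtain ⟨x, hψ, hx⟩ := hfin s hsp
  refine ⟨x, hψ, fun χ hχ => ?_⟩
  obtain ⟨χ', hχ', himp⟩ := hs χ hχ
  exact himp _ (hx χ' hχ')

end GenExp
end

section
/- Let p(x) be a complete parameter-free L₀-type realized in Y, and let π(x) be an existential quasifinite formula with p↾L(x) ⊆ π(x) ⊆ p(x). Then the following are equivalent: (1) p(x) is e-isolated by π(x); (2) π(x) ⊨ p↾1(x) holds in every σ ∈ Y. -/
open FirstOrder FirstOrder.Language

namespace GenExp

variable {L L' : FirstOrder.Language.{0,0}} {N : Type} [L.Structure N]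

section Negation

open BoundedFormula

variable {L₁ : FirstOrder.Language.{0,0}} {α : Type}

/-- The negation of a universal formula is equivalent to an existential formula. -/
theorem exists_isExistential_realize_iff_not {m : ℕ} {φ : L₁.BoundedFormula α m}
    (h : φ.IsUniversal) :
    ∃ ψ : L₁.BoundedFormula α m, ψ.IsExistential ∧
      ∀ (M : Type) [L₁.Structure M] (v : α → M) (xs : Fin m → M),
        ψ.Realize v xs ↔ ¬ φ.Realize v xs := by
  induction h with
  | of_isQF h => exact ⟨_, .of_isQF h.not, fun M _ v xs => realize_not⟩
  | all _ ih =>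
    obtain ⟨ψ, hψ, hr⟩ := ih
    exact ⟨_, hψ.ex, fun M _ v xs => by simp [realize_ex, realize_all, hr]⟩

/-- The negation of an existential formula is equivalent to a universal formula. -/
theorem exists_isUniversal_realize_iff_not {m : ℕ} {φ : L₁.BoundedFormula α m}
    (h : φ.IsExistential) :
    ∃ ψ : L₁.BoundedFormula α m, ψ.IsUniversal ∧
      ∀ (M : Type) [L₁.Structure M] (v : α → M) (xs : Fin m → M),
        ψ.Realize v xs ↔ ¬ φ.Realize v xs := by
  induction h with
  | of_isQF h => exact ⟨_, .of_isQF h.not, fun M _ v xs => realize_not⟩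
  | ex _ ih =>
    obtain ⟨ψ, hψ, hr⟩ := ih
    exact ⟨_, hψ.all, fun M _ v xs => by simp [realize_ex, realize_all, hr]⟩

end Negation

/-- Universal and existential formulas are closed under negation up to equivalence
in all expansions. -/
theorem exists_realizes_iff_not {n : ℕ} {φ : (L.sum L').Formula (Fin n)}
    (h : BoundedFormula.IsUniversal φ ∨ BoundedFormula.IsExistential φ) :
    ∃ ψ : (L.sum L').Formula (Fin n),
      (BoundedFormula.IsUniversal ψ ∨ BoundedFormula.IsExistential ψ) ∧
        ∀ (σ : Expansions L L' N) (a : Fin n → N), σ.Realizes ψ a ↔ ¬ σ.Realizes φ a := by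
  rcases h with h | h
  · obtain ⟨ψ, hψ, hr⟩ := exists_isExistential_realize_iff_not h
    exact ⟨ψ, .inr hψ, fun σ a => letI := σ.str0; hr N a default⟩
  · obtain ⟨ψ, hψ, hr⟩ := exists_isUniversal_realize_iff_not h
    exact ⟨ψ, .inl hψ, fun σ a => letI := σ.str0; hr N a default⟩

/-- An inclusion between 1-diagrams is an equality. -/
theorem diag1_eq_of_subset {σ τ : Expansions L L' N} {n : ℕ} {a b : Fin n → N}
    (h : diag1 σ a ⊆ diag1 τ b) : diag1 τ b = diag1 σ a := by
  refine Set.Subset.antisymm (fun φ hφ => ⟨?_, hφ.2⟩) h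
  by_contra hn
  obtain ⟨ψ, hψ, hr⟩ := exists_realizes_iff_not (N := N) hφ.2
  exact (hr τ b).1 (h ⟨(hr σ a).2 hn, hψ⟩).1 hφ.1

/-- Let `p(x)` be a complete parameter-free type realized in `Y` and
`π(x)` an existential quasifinite formula with `p↾L(x) ⊆ π(x) ⊆ p(x)`. Then `p` is
e-isolated by `π` if and only if `π(x) ⊨ p↾1(x)` holds in every `σ ∈ Y`. -/
theorem statement7
    (T : L.Theory) (T₀ : (L.sum L').Theory)
    [Countable N] (hNT : N ⊨ T) (hTc : T.IsComplete) (hqe : HasQE L T)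
    (hsmall : IsSmall L T) (hsat : IsSaturated L N)
    [Finite (Σ i, L'.Functions i)] [Finite (Σ i, L'.Relations i)]
    (hTT₀ : (LHom.sumInl : L →ᴸ L.sum L').onTheory T ⊆ T₀)
    (huniv : UniversalTheoryModulo L L' T T₀)
    (n : ℕ) (p : Set ((L.sum L').Formula (Fin n)))
    (hp : ∃ σ ∈ YSet L L' N T₀, ∃ a : Fin n → N, p = fullType σ a)
    (π : EQF L L' n)
    -- `p↾L(x) ⊆ π(x)`:
    (hLπ : ∀ χ : L.Formula (Fin n), (LHom.sumInl : L →ᴸ L.sum L').onFormula χ ∈ p →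
      Formula.relabel Sum.inl χ ∈ π.p)
    -- `π(x) ⊆ p(x)`:
    (hπp : ∀ σ ∈ YSet L L' N T₀, ∀ a : Fin n → N, fullType σ a = p → π.RealizeAt σ a) :
    -- `[π(x)]_S` isolates `p↾1(x)` in `S_x^Y` …
    ({q : ↥(SSet L L' N T₀ n) | ↑q ∈ SBasic L L' N T₀ π} =
        {q : ↥(SSet L L' N T₀ n) | ↑q = restr1 p}) ↔
      -- … iff `π(x) ⊨ p↾1(x)` holds in every `σ ∈ Y`.
      (∀ σ ∈ YSet L L' N T₀, ∀ a : Fin n → N, π.RealizeAt σ a →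
        ∀ φ ∈ restr1 p, σ.Realizes φ a) := by
  constructor
  · intro h σ hσ a ha φ hφ
    have hq : (⟨diag1 σ a, σ, hσ, a, rfl⟩ : ↥(SSet L L' N T₀ n)) ∈
        {q : ↥(SSet L L' N T₀ n) | ↑q ∈ SBasic L L' N T₀ π} := ⟨σ, hσ, a, rfl, ha⟩
    rw [h] at hq
    have hq' : diag1 σ a = restr1 p := hq
    exact (hq'.symm ▸ hφ : φ ∈ diag1 σ a).1
  · intro h
    obtain ⟨τ, hτ, b, rfl⟩ := hp
    ext q
    constructor
    · rintro ⟨σ, hσ, a, hq, ha⟩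
      exact hq.trans (diag1_eq_of_subset fun φ hφ => ⟨h σ hσ a ha φ hφ, hφ.2⟩)
    · intro hq
      exact ⟨τ, hτ, b, hq, hπp τ hτ b rfl⟩

end GenExp
end

section
/- Suppose all existentially closed models of T₀ have the same existential theory. Then any two e-atomic expansions of N are conjugate under Aut(N). -/
open FirstOrder FirstOrder.Language

namespace GenExp

variable {L L' : FirstOrder.Language.{0,0}} {N : Type} [L.Structure N]

/-- A back-and-forth system of finite tuples between countable sets yields a bijection all of
whose finite restrictions are covered by the system. -/
theorem exists_equiv_of_backAndForth {A B : Type*} [Countable A] [Countable B]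
    (R : ∀ n, (Fin n → A) → (Fin n → B) → Prop)
    (inj : ∀ n a b, R n a b → ∀ i j, a i = a j ↔ b i = b j)
    (forth : ∀ n a b, R n a b → ∀ c, ∃ d, R (n + 1) (Fin.cons c a) (Fin.cons d b))
    (back : ∀ n a b, R n a b → ∀ d, ∃ c, R (n + 1) (Fin.cons c a) (Fin.cons d b))
    {n₀ : ℕ} {a₀ : Fin n₀ → A} {b₀ : Fin n₀ → B} (h₀ : R n₀ a₀ b₀) :
    ∃ g : A ≃ B, (∀ i, g (a₀ i) = b₀ i) ∧
      ∀ (k : ℕ) (x : Fin k → A), ∃ n a b, R n a b ∧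
        ∃ f : Fin k → Fin n, a ∘ f = x ∧ b ∘ f = g ∘ x := by
  classical
  let P := {s : Σ n, (Fin n → A) × (Fin n → B) // R s.1 s.2.1 s.2.2}
  let pairs : P → Set (A × B) := fun s => Set.range fun i => (s.1.2.1 i, s.1.2.2 i)
  let _ : Preorder P := Preorder.lift pairs
  have le_iff : ∀ s t : P, s ≤ t ↔ pairs s ⊆ pairs t := fun s t => Iff.rfl
  have pairs_inj : ∀ s : P, ∀ p ∈ pairs s, ∀ q ∈ pairs s, p.1 = q.1 ↔ p.2 = q.2 := by
    rintro s _ ⟨i, rfl⟩ _ ⟨j, rfl⟩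
    exact inj _ _ _ s.2 i j
  let 𝒟 : A ⊕ B → Order.Cofinal P := Sum.elim
    (fun c => ⟨{s | ∃ d, (c, d) ∈ pairs s}, fun s => by
      obtain ⟨d, hd⟩ := forth _ _ _ s.2 c
      refine ⟨⟨⟨_, _, _⟩, hd⟩, ⟨d, 0, rfl⟩, ?_⟩
      rintro _ ⟨i, rfl⟩
      exact ⟨i.succ, rfl⟩⟩)
    (fun d => ⟨{s | ∃ c, (c, d) ∈ pairs s}, fun s => by
      obtain ⟨c, hc⟩ := back _ _ _ s.2 d
      refine ⟨⟨⟨_, _, _⟩, hc⟩, ⟨c, 0, rfl⟩, ?_⟩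
      rintro _ ⟨i, rfl⟩
      exact ⟨i.succ, rfl⟩⟩)
  let _ : Encodable (A ⊕ B) := Encodable.ofCountable _
  let p₀ : P := ⟨⟨n₀, a₀, b₀⟩, h₀⟩
  let I := Order.idealOfCofinals p₀ 𝒟
  have hp₀ : p₀ ∈ I := Order.mem_idealOfCofinals p₀ 𝒟
  have dir : ∀ s ∈ I, ∀ t ∈ I, ∃ u ∈ I, s ≤ u ∧ t ≤ u := fun s hs t ht => I.directed s hs t ht
  have hG : ∀ s ∈ I, ∀ t ∈ I, ∀ p ∈ pairs s, ∀ q ∈ pairs t, p.1 = q.1 ↔ p.2 = q.2 := by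
    intro s hs t ht p hp q hq
    obtain ⟨u, -, hsu, htu⟩ := dir s hs t ht
    exact pairs_inj u p (hsu hp) q (htu hq)
  have hdom : ∀ c, ∃ d, ∃ s ∈ I, (c, d) ∈ pairs s := fun c => by
    obtain ⟨s, ⟨d, hd⟩, hs⟩ := Order.cofinal_meets_idealOfCofinals p₀ 𝒟 (Sum.inl c)
    exact ⟨d, s, hs, hd⟩
  have hran : ∀ d, ∃ c, ∃ s ∈ I, (c, d) ∈ pairs s := fun d => by
    obtain ⟨s, ⟨c, hc⟩, hs⟩ := Order.cofinal_meets_idealOfCofinals p₀ 𝒟 (Sum.inr d)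
    exact ⟨c, s, hs, hc⟩
  choose g s hs hgs using hdom
  choose g' t ht hgt using hran
  refine ⟨⟨g, g', fun c => ?_, fun d => ?_⟩, fun i => ?_, fun k x => ?_⟩
  · exact (hG _ (ht (g c)) _ (hs c) _ (hgt (g c)) _ (hgs c)).2 rfl
  · exact (hG _ (hs (g' d)) _ (ht d) _ (hgs (g' d)) _ (hgt d)).1 rfl
  · exact (hG _ (hs (a₀ i)) _ hp₀ _ (hgs (a₀ i)) (a₀ i, b₀ i) ⟨i, rfl⟩).1 rfl
  · have : ∃ u ∈ I, ∀ i, s (x i) ≤ u := by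
      induction k with
      | zero => exact ⟨p₀, hp₀, fun i => i.elim0⟩
      | succ k ih =>
        obtain ⟨u, hu, hxu⟩ := ih (Fin.tail x)
        obtain ⟨v, hv, huv, hxv⟩ := dir u hu _ (hs (x 0))
        exact ⟨v, hv, fun i => Fin.cases hxv (fun j => (hxu j).trans huv) i⟩
    obtain ⟨u, -, hu⟩ := this
    have hx : ∀ i, ∃ j, (u.1.2.1 j, u.1.2.2 j) = (x i, g (x i)) := fun i => hu i (hgs (x i))
    choose f hf using hx
    exact ⟨_, _, _, u.2, f, funext fun i => congrArg Prod.fst (hf i),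
      funext fun i => congrArg Prod.snd (hf i)⟩

/-- A back-and-forth system preserving quantifier-free formulas yields an isomorphism. -/
theorem exists_languageEquiv_of_backAndForth {L₁ : FirstOrder.Language.{0,0}} {A B : Type}
    [L₁.Structure A] [L₁.Structure B] [Countable A] [Countable B]
    (R : ∀ n, (Fin n → A) → (Fin n → B) → Prop)
    (hR : ∀ n a b, R n a b → ∀ φ : L₁.Formula (Fin n), φ.IsQF → (φ.Realize a ↔ φ.Realize b))
    (forth : ∀ n a b, R n a b → ∀ c, ∃ d, R (n + 1) (Fin.cons c a) (Fin.cons d b))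
    (back : ∀ n a b, R n a b → ∀ d, ∃ c, R (n + 1) (Fin.cons c a) (Fin.cons d b))
    {n₀ : ℕ} {a₀ : Fin n₀ → A} {b₀ : Fin n₀ → B} (h₀ : R n₀ a₀ b₀) :
    ∃ g : A ≃[L₁] B, ∀ i, g (a₀ i) = b₀ i := by
  obtain ⟨g, hg₀, hg⟩ := exists_equiv_of_backAndForth R (fun n a b h i j => by
    have := hR n a b h (Term.equal (Term.var i) (Term.var j))
      (BoundedFormula.IsAtomic.equal _ _).isQF
    simpa [Formula.realize_equal] using this) forth back h₀
  have key : ∀ (k : ℕ) (x : Fin k → A) (φ : L₁.Formula (Fin k)), φ.IsQF →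
      (φ.Realize x ↔ φ.Realize (g ∘ x)) := by
    intro k x φ hφ
    obtain ⟨n, a, b, hab, f, hfa, hfb⟩ := hg k x
    have := hR n a b hab (φ.relabel f) (hφ.relabel _)
    rwa [Formula.realize_relabel, Formula.realize_relabel, hfa, hfb] at this
  refine ⟨⟨g, fun {k} F x => ?_, fun {k} r x => ?_⟩, hg₀⟩
  · have := (key (k + 1) (Fin.cons (Structure.funMap F x) x) (Formula.graph F)
      (BoundedFormula.IsAtomic.equal _ _).isQF).1 (by simp [Formula.realize_graph])
    rw [Fin.comp_cons] at this
    exact (Formula.realize_graph.1 this).symm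
  · have := key k x (r.formula Term.var) (BoundedFormula.IsAtomic.rel _ _).isQF
    simpa [Formula.realize_rel, Function.comp_def] using this.symm

/-- `(N, σ)` realizes the `L₀`-formula `φ` at the assignment `v`. -/
def Expansions.Sat {ι : Type} (σ : Expansions L L' N) (φ : (L.sum L').Formula ι) (v : ι → N) :
    Prop :=
  letI := σ.str0
  φ.Realize v

theorem Expansions.sat_relabel {ι κ : Type} (σ : Expansions L L' N) (φ : (L.sum L').Formula ι)
    (f : ι → κ) (v : κ → N) : σ.Sat (φ.relabel f) v ↔ σ.Sat φ (v ∘ f) :=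
  letI := σ.str0
  Formula.realize_relabel

theorem Expansions.sat_inf {ι : Type} (σ : Expansions L L' N) (φ ψ : (L.sum L').Formula ι)
    (v : ι → N) : σ.Sat (φ ⊓ ψ) v ↔ σ.Sat φ v ∧ σ.Sat ψ v :=
  letI := σ.str0
  Formula.realize_inf

theorem Expansions.sat_iExs {ι : Type} {m : ℕ} (σ : Expansions L L' N)
    (φ : (L.sum L').Formula (ι ⊕ Fin m)) (v : ι → N) :
    σ.Sat (φ.iExs (Fin m)) v ↔ ∃ y, σ.Sat φ (Sum.elim v y) :=
  letI := σ.str0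
  Formula.realize_iExs

theorem Expansions.sat_onFormula {ι : Type} (σ : Expansions L L' N) (φ : L.Formula ι)
    (v : ι → N) : σ.Sat ((LHom.sumInl : L →ᴸ L.sum L').onFormula φ) v ↔ φ.Realize v :=
  @LHom.realize_onFormula L (L.sum L') N _ ι σ.str0 LHom.sumInl
    (@LHom.sumInl_isExpansionOn L L' N _ σ.str) φ v

theorem isQF_onBoundedFormula {L₁ L₂ : FirstOrder.Language} (h : L₁ →ᴸ L₂) {ι : Type*} {n : ℕ}
    {φ : L₁.BoundedFormula ι n} (hφ : φ.IsQF) : (h.onBoundedFormula φ).IsQF := by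
  induction hφ with
  | falsum => exact .falsum
  | of_isAtomic hA =>
    cases hA with
    | equal t₁ t₂ => exact (BoundedFormula.IsAtomic.equal _ _).isQF
    | rel r ts => exact (BoundedFormula.IsAtomic.rel _ _).isQF
  | imp _ _ ih₁ ih₂ => exact ih₁.imp ih₂

theorem isExistential_exs {L₁ : FirstOrder.Language} {ι : Type*} {n : ℕ}
    {φ : L₁.BoundedFormula ι n} (hφ : φ.IsExistential) : φ.exs.IsExistential := by
  induction n with
  | zero => exact hφ
  | succ n ih => exact ih hφ.ex

theorem isExistential_iExs {L₁ : FirstOrder.Language} {ι : Type*} {m : ℕ}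
    {φ : L₁.Formula (ι ⊕ Fin m)} (hφ : φ.IsQF) : (φ.iExs (Fin m)).IsExistential :=
  isExistential_exs (hφ.relabel _).isExistential

/-- In a model of a theory with quantifier elimination, every formula in finitely many variables
is equivalent to a quantifier-free one. -/
theorem HasQE.exists_isQF {T : L.Theory} (hqe : HasQE L T) (hNT : N ⊨ T) {ι : Type} [Finite ι]
    (φ : L.Formula ι) : ∃ ψ : L.Formula ι, ψ.IsQF ∧ ∀ v : ι → N, ψ.Realize v ↔ φ.Realize v := by
  rcases isEmpty_or_nonempty N with hN | hN
  · rcases isEmpty_or_nonempty ι with hι | ⟨⟨i⟩⟩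
    · by_cases h : φ.Realize (isEmptyElim : ι → N)
      · refine ⟨⊤, BoundedFormula.isQF_bot.not, fun v => ?_⟩
        rw [Subsingleton.elim v isEmptyElim]
        simpa using h
      · refine ⟨⊥, BoundedFormula.isQF_bot, fun v => ?_⟩
        rw [Subsingleton.elim v isEmptyElim]
        simpa using h
    · exact ⟨⊥, BoundedFormula.isQF_bot, fun v => hN.elim (v i)⟩
  · obtain ⟨n, ⟨e⟩⟩ := Finite.exists_equiv_fin ι
    obtain ⟨ψ, hψ, h⟩ := hqe n (φ.relabel e)
    refine ⟨ψ.relabel e.symm, hψ.relabel _, fun v => ?_⟩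
    have := Formula.realize_iff.1 (h.realize_formula N (v := v ∘ e.symm))
    rw [Formula.realize_relabel, Function.comp_assoc, Equiv.symm_comp_self,
      Function.comp_id] at this
    rw [Formula.realize_relabel]
    exact this.symm

theorem HasQE.exists_isQF_finset {T : L.Theory} (hqe : HasQE L T) (hNT : N ⊨ T) {ι : Type}
    [Finite ι] (s : Finset (L.Formula ι)) :
    ∃ ψ : L.Formula ι, ψ.IsQF ∧ ∀ v : ι → N, ψ.Realize v ↔ ∀ χ ∈ s, χ.Realize v := by
  obtain ⟨ψ, hψ, h⟩ := hqe.exists_isQF hNT (Formula.iInf fun χ : s => χ.1)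
  exact ⟨ψ, hψ, fun v => by simp [h]⟩

/-- Tuples of a countable saturated structure with the same type are conjugate. -/
theorem IsSaturated.exists_equiv [Countable N] (hsat : IsSaturated L N) {n : ℕ}
    {a b : Fin n → N} (hab : ∀ φ : L.Formula (Fin n), φ.Realize a ↔ φ.Realize b) :
    ∃ g : N ≃[L] N, g ∘ a = b := by
  have forth : ∀ (n : ℕ) (a b : Fin n → N),
      (∀ φ : L.Formula (Fin n), φ.Realize a ↔ φ.Realize b) → ∀ c, ∃ d,
        ∀ φ : L.Formula (Fin (n + 1)),
          φ.Realize (Fin.cons c a : Fin (n + 1) → N) ↔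
            φ.Realize (Fin.cons d b : Fin (n + 1) → N) := by
    intro n a b hab c
    obtain ⟨d, hd⟩ := hsat n b {φ | φ.Realize (Sum.elim a fun _ => c)} fun s hs => by
      have h := (hab ((Formula.iInf fun χ : s => χ.1).iExs (Fin 1))).1 (by
        rw [Formula.realize_iExs]
        refine ⟨fun _ => c, ?_⟩
        exact Formula.realize_iInf.2 fun χ => hs χ.2)
      rw [Formula.realize_iExs] at h
      obtain ⟨y, hy⟩ := h
      refine ⟨y 0, fun φ hφ => ?_⟩
      have := Formula.realize_iInf.1 hy ⟨φ, hφ⟩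
      rwa [show y = fun _ => y 0 from funext fun i => by rw [Subsingleton.elim i 0] ] at this
    have key : ∀ φ : L.Formula (Fin (n + 1)),
        φ.Realize (Fin.cons c a : Fin (n + 1) → N) →
          φ.Realize (Fin.cons d b : Fin (n + 1) → N) := by
      intro φ hφ
      have e : ∀ (x : N) (w : Fin n → N),
          (Sum.elim w fun _ : Fin 1 => x) ∘ (Fin.cons (Sum.inr 0) Sum.inl) =
            (Fin.cons x w : Fin (n + 1) → N) := fun x w => by
        rw [Fin.comp_cons]
        rfl
      have := hd (φ.relabel (Fin.cons (Sum.inr 0) Sum.inl)) (by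
        rw [Set.mem_ofPred_eq, Formula.realize_relabel, e]
        exact hφ)
      rwa [Formula.realize_relabel, e] at this
    refine ⟨d, fun φ => ⟨key φ, fun h => ?_⟩⟩
    by_contra hφ
    exact Formula.realize_not.1 (key φ.not (Formula.realize_not.2 hφ)) h
  obtain ⟨g, hg⟩ := exists_languageEquiv_of_backAndForth (L₁ := L) (A := N) (B := N)
    (fun n a b => ∀ φ : L.Formula (Fin n), φ.Realize a ↔ φ.Realize b)
    (fun n a b h φ _ => h φ) forth
    (fun n a b h d => by
      obtain ⟨c, hc⟩ := forth n b a (fun φ => (h φ).symm) d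
      exact ⟨c, fun φ => (hc φ).symm⟩) hab
  exact ⟨g, funext hg⟩

/-- Every existential formula satisfied by `a` in `(N, σ)` is satisfied by `b` in `(N, τ)`. -/
def ExistentialLE (σ : Expansions L L' N) {n : ℕ} (a : Fin n → N) (τ : Expansions L L' N)
    (b : Fin n → N) : Prop :=
  ∀ (m : ℕ) (φ : (L.sum L').Formula (Fin n ⊕ Fin m)), φ.IsQF →
    (∃ y, σ.Sat φ (Sum.elim a y)) → ∃ y, τ.Sat φ (Sum.elim b y)

theorem ExistentialLE.trans {σ τ ρ : Expansions L L' N} {n : ℕ} {a b c : Fin n → N}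
    (h₁ : ExistentialLE σ a τ b) (h₂ : ExistentialLE τ b ρ c) : ExistentialLE σ a ρ c :=
  fun m φ hφ h => h₂ m φ hφ (h₁ m φ hφ h)

theorem ExistentialLE.of_diag1_eq {σ τ : Expansions L L' N} {n : ℕ} {a b : Fin n → N}
    (h : diag1 σ a = diag1 τ b) : ExistentialLE σ a τ b := by
  intro m φ hφ hy
  have : φ.iExs (Fin m) ∈ diag1 σ a :=
    ⟨(σ.sat_iExs φ a).2 hy, Or.inr (isExistential_iExs hφ)⟩
  rw [h] at this
  exact (τ.sat_iExs φ b).1 this.1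

theorem ExistentialLE.sat {σ τ : Expansions L L' N} {n : ℕ} {a b : Fin n → N}
    (h : ExistentialLE σ a τ b) {φ : (L.sum L').Formula (Fin n)} (hφ : φ.IsQF)
    (ha : σ.Sat φ a) : τ.Sat φ b := by
  have := h 0 (φ.relabel Sum.inl) (hφ.relabel _) ⟨Fin.elim0, by
    rw [Expansions.sat_relabel]
    exact ha⟩
  obtain ⟨y, hy⟩ := this
  rw [Expansions.sat_relabel] at hy
  exact hy

/-- Smooth expansions inherit existential quasifinite formulas along existential types. -/
theorem EQF.RealizeAt.of_existentialLE {T : L.Theory} (hNT : N ⊨ T) (hqe : HasQE L T)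
    {σ τ : Expansions L L' N} (hτ : τ.IsSmooth) {n : ℕ} {a b : Fin n → N}
    (h : ExistentialLE σ a τ b) {π : EQF L L' n} (hπ : π.RealizeAt σ a) : π.RealizeAt τ b := by
  obtain ⟨y, hp, hφ⟩ := hπ
  obtain ⟨z, hz, hzp⟩ := hτ n π.m b π.p π.φ π.qf fun s hs => by
    obtain ⟨ψ, hψ, hψs⟩ := hqe.exists_isQF_finset hNT s
    obtain ⟨z, hz⟩ := h π.m (π.φ ⊓ (LHom.sumInl : L →ᴸ L.sum L').onFormula ψ)
      (π.qf.inf (isQF_onBoundedFormula _ hψ)) ⟨y, by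
        rw [Expansions.sat_inf, Expansions.sat_onFormula, hψs]
        exact ⟨hφ, fun χ hχ => hp χ (hs hχ)⟩⟩
    rw [Expansions.sat_inf, Expansions.sat_onFormula, hψs] at hz
    exact ⟨z, hz⟩
  exact ⟨z, hzp, hz⟩

/-- The conjunction of two existential quasifinite formulas. -/
def EQF.inf {n : ℕ} (π ρ : EQF L L' n) : EQF L L' n where
  m := π.m + ρ.m
  p := Formula.relabel (Sum.map id (Fin.castAdd ρ.m)) '' π.p ∪
    Formula.relabel (Sum.map id (Fin.natAdd π.m)) '' ρ.p
  φ := π.φ.relabel (Sum.map id (Fin.castAdd ρ.m)) ⊓ ρ.φ.relabel (Sum.map id (Fin.natAdd π.m))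
  qf := (π.qf.relabel _).inf (ρ.qf.relabel _)

theorem EQF.realizeAt_inf {n : ℕ} (π ρ : EQF L L' n) (σ : Expansions L L' N) (b : Fin n → N) :
    (π.inf ρ).RealizeAt σ b ↔ π.RealizeAt σ b ∧ ρ.RealizeAt σ b := by
  change (∃ y : Fin (π.m + ρ.m) → N,
    (∀ χ ∈ Formula.relabel (Sum.map id (Fin.castAdd ρ.m)) '' π.p ∪
      Formula.relabel (Sum.map id (Fin.natAdd π.m)) '' ρ.p, χ.Realize (Sum.elim b y)) ∧
    σ.Sat (π.φ.relabel (Sum.map id (Fin.castAdd ρ.m)) ⊓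
      ρ.φ.relabel (Sum.map id (Fin.natAdd π.m))) (Sum.elim b y)) ↔ _
  constructor
  · rintro ⟨y, hp, hφ⟩
    rw [Expansions.sat_inf, Expansions.sat_relabel, Expansions.sat_relabel, Sum.elim_comp_map,
      Sum.elim_comp_map] at hφ
    refine ⟨⟨y ∘ Fin.castAdd ρ.m, fun χ hχ => ?_, hφ.1⟩,
      ⟨y ∘ Fin.natAdd π.m, fun χ hχ => ?_, hφ.2⟩⟩
    · have := hp _ (Or.inl ⟨χ, hχ, rfl⟩)
      rwa [Formula.realize_relabel, Sum.elim_comp_map] at this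
    · have := hp _ (Or.inr ⟨χ, hχ, rfl⟩)
      rwa [Formula.realize_relabel, Sum.elim_comp_map] at this
  · rintro ⟨⟨y, hp, hφ⟩, ⟨z, hq, hψ⟩⟩
    have hl : (Fin.append y z : Fin (π.m + ρ.m) → N) ∘ Fin.castAdd ρ.m = y :=
      funext fun i => Fin.append_left y z i
    have hr : (Fin.append y z : Fin (π.m + ρ.m) → N) ∘ Fin.natAdd π.m = z :=
      funext fun i => Fin.append_right y z i
    refine ⟨Fin.append y z, ?_, (σ.sat_inf _ _ _).2 ⟨?_, ?_⟩⟩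
    · rintro _ (⟨χ, hχ, rfl⟩ | ⟨χ, hχ, rfl⟩)
      · rw [Formula.realize_relabel, Sum.elim_comp_map, hl]
        exact hp χ hχ
      · rw [Formula.realize_relabel, Sum.elim_comp_map, hr]
        exact hq χ hχ
    · rw [Expansions.sat_relabel, Sum.elim_comp_map, hl]
      exact hφ
    · rw [Expansions.sat_relabel, Sum.elim_comp_map, hr]
      exact hψ

/-- The sets `[π(b)]_D` form a basis of the topology on `D_b`. -/
theorem exists_eqf_of_isOpen {T : L.Theory} (hNT : N ⊨ T) (hqe : HasQE L T)
    {T₀ : (L.sum L').Theory} {n : ℕ} {b : Fin n → N} {U : Set ↥(DSet L L' N T₀ b)}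
    (hU : @IsOpen _ (DTop L L' N T₀ b) U) {σ : Expansions L L' N} (hσ : σ ∈ YSet L L' N T₀)
    (hσU : ⟨diag1 σ b, σ, hσ, rfl⟩ ∈ U) :
    ∃ π : EQF L L' n, π.RealizeAt σ b ∧
      ∀ (τ : Expansions L L' N) (hτ : τ ∈ YSet L L' N T₀), π.RealizeAt τ b →
        (⟨diag1 τ b, τ, hτ, rfl⟩ : ↥(DSet L L' N T₀ b)) ∈ U := by
  replace hU : TopologicalSpace.GenerateOpen
    {s : Set ↥(DSet L L' N T₀ b) | ∃ π : EQF L L' n,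
      Subtype.val '' s = {d | d ∈ DBasic L L' N T₀ b π}} U := hU
  induction hU with
  | basic s hs =>
    obtain ⟨π, hs⟩ := hs
    obtain ⟨τ, -, hστ, hπ⟩ := hs.subset (Set.mem_image_of_mem _ hσU)
    refine ⟨π, hπ.of_existentialLE hNT hqe hσ.2.1 (.of_diag1_eq hστ.symm), fun ρ hρ h => ?_⟩
    exact (Subtype.val_injective.mem_set_image).1 (hs.superset ⟨ρ, hρ, rfl, h⟩)
  | univ =>
    exact ⟨⟨0, ∅, ⊤, BoundedFormula.isQF_bot.not⟩,
      ⟨Fin.elim0, fun χ hχ => hχ.elim, id⟩, fun _ _ _ => trivial⟩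
  | inter s t _ _ ihs iht =>
    obtain ⟨π, hπ, hs⟩ := ihs hσU.1
    obtain ⟨ρ, hρ, ht⟩ := iht hσU.2
    refine ⟨π.inf ρ, (EQF.realizeAt_inf _ _ _ _).2 ⟨hπ, hρ⟩, fun τ hτ h => ?_⟩
    rw [EQF.realizeAt_inf] at h
    exact ⟨hs τ hτ h.1, ht τ hτ h.2⟩
  | sUnion S _ ih =>
    obtain ⟨s, hs, h⟩ := hσU
    obtain ⟨π, hπ, hπs⟩ := ih s hs h
    exact ⟨π, hπ, fun τ hτ hτπ => ⟨s, hs, hπs τ hτ hτπ⟩⟩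

/-- An `L`-automorphism `g` of `N` is an isomorphism from `(N, σ)` to `(N, σ^g)`. -/
def conjEquiv (g : N ≃[L] N) (σ : Expansions L L' N) :
    @FirstOrder.Language.Equiv (L.sum L') N N σ.str0 (conjExp g σ).str0 :=
  @FirstOrder.Language.Equiv.mk (L.sum L') N N σ.str0 (conjExp g σ).str0 g.toEquiv
    (fun {n} F x => by
      cases F with
      | inl F => exact g.map_fun F x
      | inr F =>
        change g (σ.str.funMap F x) = g (σ.str.funMap F fun i => g.symm (g (x i)))
        simp)
    (fun {n} r x => by
      cases r with
      | inl r => exact g.map_rel r x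
      | inr r =>
        change σ.str.RelMap r (fun i => g.symm (g (x i))) ↔ σ.str.RelMap r x
        simp)

theorem sat_conjExp (g : N ≃[L] N) (σ : Expansions L L' N) {ι : Type}
    (φ : (L.sum L').Formula ι) (v : ι → N) : (conjExp g σ).Sat φ (g ∘ v) ↔ σ.Sat φ v :=
  @StrongHomClass.realize_formula (L.sum L') N N σ.str0 (conjExp g σ).str0 ι _
    (@FirstOrder.Language.Equiv.instEquivLike _ _ _ σ.str0 (conjExp g σ).str0)
    (@FirstOrder.Language.Equiv.instStrongHomClass _ _ _ σ.str0 (conjExp g σ).str0)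
    (conjEquiv g σ) φ v

/-- Expansions with isomorphic `L₀`-structures are conjugate. -/
theorem exists_conjExp_eq {σ τ : Expansions L L' N}
    (e : @FirstOrder.Language.Equiv (L.sum L') N N σ.str0 τ.str0) :
    ∃ g : N ≃[L] N, conjExp g σ = τ := by
  let E := @FirstOrder.Language.Equiv.toEquiv _ _ _ σ.str0 τ.str0 e
  have hfun := @FirstOrder.Language.Equiv.map_fun' _ _ _ σ.str0 τ.str0 e
  have hrel := @FirstOrder.Language.Equiv.map_rel' _ _ _ σ.str0 τ.str0 e
  let g : N ≃[L] N :=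
    { toEquiv := E
      map_fun' := fun F x => hfun (Sum.inl F) x
      map_rel' := fun r x => hrel (Sum.inl r) x }
  have hg : ∀ {k : ℕ} (x : Fin k → N), (fun i => E (g.symm (x i))) = x := fun x =>
    funext fun i => g.apply_symm_apply (x i)
  refine ⟨g, Structure.ext ?_ ?_⟩
  · funext k F x
    exact (hfun (Sum.inr F) fun i => g.symm (x i)).trans (congrArg (τ.str.funMap F) (hg x))
  · funext k r x
    exact (propext (hrel (Sum.inr r) fun i => g.symm (x i))).symm.trans
      (congrArg (τ.str.RelMap r) (hg x))

theorem existentialLE_conjExp (g : N ≃[L] N) (σ : Expansions L L' N) {n : ℕ} (a : Fin n → N) :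
    ExistentialLE σ a (conjExp g σ) (g ∘ a) := by
  rintro m φ - ⟨y, hy⟩
  refine ⟨g ∘ y, ?_⟩
  rw [← Sum.comp_elim, sat_conjExp]
  exact hy

theorem conjExp_existentialLE (g : N ≃[L] N) (σ : Expansions L L' N) {n : ℕ} (a : Fin n → N) :
    ExistentialLE (conjExp g σ) (g ∘ a) σ a := by
  rintro m φ - ⟨y, hy⟩
  refine ⟨g.symm ∘ y, ?_⟩
  rw [← sat_conjExp g, Sum.comp_elim, ← Function.comp_assoc]
  convert hy using 2
  funext i
  simp

theorem IsECModel.of_equiv {T₀ : (L.sum L').Theory} {U V : Type} [L.Structure U]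
    [L'.Structure U] [L.Structure V] [L'.Structure V] (e : U ≃[L.sum L'] V)
    (hU : IsECModel L L' T₀ U) : IsECModel L L' T₀ V := by
  have := hU.1
  refine ⟨StrongHomClass.theory_model e, ?_⟩
  rintro k n φ c hφ ⟨W, iW, iW', j, hW, x, hx⟩
  have hc : e ∘ e.symm ∘ c = c := by
    funext i
    simp
  obtain ⟨x', hx'⟩ := hU.2 k n φ (e.symm ∘ c) hφ
    ⟨W, iW, iW', j.comp e.toEmbedding, hW, x, by
      convert hx using 3
      funext i
      simp⟩
  refine ⟨e ∘ x', ?_⟩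
  rw [← hc, ← Sum.comp_elim]
  exact (StrongHomClass.realize_formula e φ).2 hx'

theorem conjExp_mem_YSet (g : N ≃[L] N) {T₀ : (L.sum L').Theory} {σ : Expansions L L' N}
    (hσ : σ ∈ YSet L L' N T₀) : conjExp g σ ∈ YSet L L' N T₀ := by
  obtain ⟨hM, hS, hE⟩ := hσ
  obtain ⟨hM', hE'⟩ := @IsECModel.of_equiv L L' T₀ N N _ σ.str _ (conjExp g σ).str
    (conjEquiv g σ) ⟨hM, hE⟩
  refine ⟨hM', fun k n c p ψ hψ h => ?_, hE'⟩
  have hc : g ∘ g.symm ∘ c = c := by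
    funext i
    simp
  obtain ⟨x, hx, hxp⟩ := hS k n (g.symm ∘ c) p ψ hψ fun s hs => by
    obtain ⟨x, hx, hxs⟩ := h s hs
    have e : (Sum.elim c x : Fin k ⊕ Fin n → N) =
        g ∘ Sum.elim (g.symm ∘ c) (g.symm ∘ x) := by
      rw [Sum.comp_elim, hc]
      congr 1
      funext i
      simp
    rw [e] at hx hxs
    exact ⟨g.symm ∘ x, (sat_conjExp g σ ψ _).1 hx, fun χ hχ =>
      (StrongHomClass.realize_formula g χ).1 (hxs χ hχ)⟩
  refine ⟨g ∘ x, ?_⟩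
  rw [← hc, ← Sum.comp_elim]
  exact ⟨(sat_conjExp g σ ψ _).2 hx, fun χ hχ =>
    (StrongHomClass.realize_formula g χ).2 (hxp χ hχ)⟩

theorem IsEAtomic.forth {T : L.Theory} [Countable N] (hNT : N ⊨ T) (hqe : HasQE L T)
    (hsat : IsSaturated L N) {T₀ : (L.sum L').Theory} {σ τ : Expansions L L' N}
    (hσ : IsEAtomic L L' N T₀ σ) (hτ : τ ∈ YSet L L' N T₀) {n : ℕ} {a b : Fin n → N}
    (hab : ExistentialLE σ a τ b) (c : N) :
    ∃ d, ExistentialLE σ (Fin.cons c a : Fin (n + 1) → N) τ (Fin.cons d b : Fin (n + 1) → N) ∧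
      ExistentialLE τ (Fin.cons d b : Fin (n + 1) → N) σ (Fin.cons c a : Fin (n + 1) → N) := by
  obtain ⟨π, hπσ, hπ⟩ := exists_eqf_of_isOpen hNT hqe (hσ.2 (n + 1) (Fin.cons c a)) hσ.1 rfl
  obtain ⟨y, hyp, hyφ⟩ := hπσ
  let f : Fin (n + 1) ⊕ Fin π.m → Fin n ⊕ Fin (π.m + 1) :=
    Sum.elim (Fin.cons (Sum.inr 0) Sum.inl) (Sum.inr ∘ Fin.succ)
  have hf : ∀ (w : Fin n → N) (z : Fin (π.m + 1) → N),
      Sum.elim w z ∘ f = Sum.elim (Fin.cons (z 0) w : Fin (n + 1) → N) (Fin.tail z) := by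
    intro w z
    rw [Sum.comp_elim, Fin.comp_cons]
    rfl
  let ρ : EQF L L' n :=
    ⟨π.m + 1,
      Formula.relabel f '' (π.p ∪ {χ | ∃ θ : L.Formula (Fin (n + 1)),
        θ.Realize (Fin.cons c a : Fin (n + 1) → N) ∧ θ.relabel Sum.inl = χ}),
      π.φ.relabel f, π.qf.relabel _⟩
  have hρ : ρ.RealizeAt σ a := by
    refine ⟨(Fin.cons c y : Fin (π.m + 1) → N), ?_, ?_⟩
    · rintro _ ⟨χ, hχ, rfl⟩
      refine Formula.realize_relabel.2 ?_
      rw [hf]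
      rcases hχ with hχ | ⟨θ, hθ, rfl⟩
      · exact hyp χ hχ
      · exact Formula.realize_relabel.2 hθ
    · refine (σ.sat_relabel _ _ _).2 ?_
      rw [hf]
      exact hyφ
  obtain ⟨z, hzp, hzφ⟩ := hρ.of_existentialLE hNT hqe hτ.2.1 hab
  replace hzφ := (τ.sat_relabel _ _ _).1 hzφ
  rw [hf] at hzφ
  have hz : ∀ χ ∈ π.p ∪ {χ | ∃ θ : L.Formula (Fin (n + 1)),
      θ.Realize (Fin.cons c a : Fin (n + 1) → N) ∧ θ.relabel Sum.inl = χ},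
      χ.Realize (Sum.elim (Fin.cons (z 0) b : Fin (n + 1) → N) (Fin.tail z)) := by
    intro χ hχ
    have := Formula.realize_relabel.1 (hzp _ ⟨χ, hχ, rfl⟩)
    rwa [hf] at this
  have htp : ∀ θ : L.Formula (Fin (n + 1)), θ.Realize (Fin.cons c a : Fin (n + 1) → N) →
      θ.Realize (Fin.cons (z 0) b : Fin (n + 1) → N) := fun θ hθ => by
    have := hz _ (Or.inr ⟨θ, hθ, rfl⟩)
    rwa [Formula.realize_relabel, Sum.elim_comp_inl] at this
  obtain ⟨g, hg⟩ := hsat.exists_equiv (a := (Fin.cons (z 0) b : Fin (n + 1) → N))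
    (b := (Fin.cons c a : Fin (n + 1) → N)) fun θ => ⟨fun h => by
      by_contra hθ
      exact Formula.realize_not.1 (htp θ.not (Formula.realize_not.2 hθ)) h, htp θ⟩
  have hle := existentialLE_conjExp g τ (Fin.cons (z 0) b : Fin (n + 1) → N)
  have hge := conjExp_existentialLE g τ (Fin.cons (z 0) b : Fin (n + 1) → N)
  rw [hg] at hle hge
  have hY := conjExp_mem_YSet g hτ
  have hπτ : π.RealizeAt τ (Fin.cons (z 0) b) :=
    ⟨Fin.tail z, fun χ hχ => hz χ (Or.inl hχ), hzφ⟩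
  have hdiag : diag1 (conjExp g τ) (Fin.cons c a : Fin (n + 1) → N) = diag1 σ (Fin.cons c a) :=
    hπ _ hY (hπτ.of_existentialLE hNT hqe hY.2.1 hle)
  exact ⟨z 0, (ExistentialLE.of_diag1_eq hdiag.symm).trans hge,
    hle.trans (.of_diag1_eq hdiag)⟩

theorem existentialLE_elim0 {T₀ : (L.sum L').Theory} (hsame : SameExistentialTheory L L' T₀)
    {σ τ : Expansions L L' N} (hσ : σ ∈ YSet L L' N T₀) (hτ : τ ∈ YSet L L' N T₀) :
    ExistentialLE σ (Fin.elim0 : Fin 0 → N) τ (Fin.elim0 : Fin 0 → N) := by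
  intro m φ hφ hy
  let f : Fin 0 ⊕ Fin m → Empty ⊕ Fin m := Sum.map Fin.elim0 id
  have key : ∀ ρ : Expansions L L' N,
      ρ.Sat ((φ.relabel f).iExs (Fin m)) (default : Empty → N) ↔
        ∃ y, ρ.Sat φ (Sum.elim Fin.elim0 y) := by
    intro ρ
    rw [Expansions.sat_iExs]
    refine exists_congr fun y => ?_
    rw [Expansions.sat_relabel, Sum.elim_comp_map, Function.comp_id,
      Subsingleton.elim ((default : Empty → N) ∘ Fin.elim0) Fin.elim0]
  exact (key τ).1 ((@hsame N _ σ.str N _ τ.str ⟨hσ.1, hσ.2.2⟩ ⟨hτ.1, hτ.2.2⟩ _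
    (isExistential_iExs (hφ.relabel _))).1 ((key σ).2 hy))

/-- If all existentially closed models of `T₀` have the same
existential theory, then any two e-atomic expansions of `N` are conjugate under
`Aut(N)`. -/
theorem statement8
    (T : L.Theory) (T₀ : (L.sum L').Theory)
    [Countable N] (hNT : N ⊨ T) (hTc : T.IsComplete) (hqe : HasQE L T)
    (hsmall : IsSmall L T) (hsat : IsSaturated L N)
    [Finite (Σ i, L'.Functions i)] [Finite (Σ i, L'.Relations i)]
    (hTT₀ : (LHom.sumInl : L →ᴸ L.sum L').onTheory T ⊆ T₀)
    (huniv : UniversalTheoryModulo L L' T T₀)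
    (hsame : SameExistentialTheory L L' T₀)
    (α β : Expansions L L' N)
    (hα : IsEAtomic L L' N T₀ α) (hβ : IsEAtomic L L' N T₀ β) :
    ∃ g : N ≃[L] N, conjExp g α = β := by
  obtain ⟨g, -⟩ := @exists_languageEquiv_of_backAndForth (L.sum L') N N α.str0 β.str0 _ _
    (fun n a b => ExistentialLE α a β b ∧ ExistentialLE β b α a)
    (fun n a b h φ hφ => ⟨h.1.sat hφ, h.2.sat hφ⟩)
    (fun n a b h c => hα.forth hNT hqe hsat hβ.1 h.1 c)
    (fun n a b h d => (hβ.forth hNT hqe hsat hα.1 h.2 d).imp fun _ h => h.symm)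
    0 Fin.elim0 Fin.elim0
    ⟨existentialLE_elim0 hsame hα.1 hβ.1, existentialLE_elim0 hsame hβ.1 hα.1⟩
  exact exists_conjExp_eq g

end GenExp
end
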